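/- arXiv:1412.8257 — 7 statements merged into one kernel-verified Lean document; each statement's English description precedes it below -/
import Mathlib

section
/- Let m be a positive integer. For every twice continuously differentiable function F : ℍ×ℂ → ℂ and every X = (λ,μ) ∈ ℤ², the heat operator commutes with the elliptic slash action: H_m(F|_m X) = (H_m F)|_m X on ℍ×ℂ. -/
open Complex

noncomputable section

/-- Holomorphic Wirtinger derivative. -/
def wder (f : ℂ → ℂ) (w : ℂ) : ℂ :=
  (fderiv ℝ f w 1 - Complex.I * fderiv ℝ f w Complex.I) / 2

/-- The index-`m` heat operator `H_m = 8πim ∂_τ − ∂_z²`. -/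
def heatOp (m : ℕ) (F : ℂ → ℂ → ℂ) : ℂ → ℂ → ℂ :=
  fun τ z => 8 * (Real.pi : ℂ) * Complex.I * (m : ℂ) * wder (fun w => F w z) τ
    - wder (wder (F τ)) z

/-- The index-`m` elliptic slash operator `F ↦ F|_m X` for `X = (λ,μ) ∈ ℤ²`. -/
def ellSlash (m : ℕ) (X : ℤ × ℤ) (F : ℂ → ℂ → ℂ) : ℂ → ℂ → ℂ :=
  fun τ z =>
    Complex.exp (2 * (Real.pi : ℂ) * Complex.I * (m : ℂ) *
      ((X.1 : ℂ) ^ 2 * τ + 2 * (X.1 : ℂ) * z + (X.2 : ℂ) * (X.1 : ℂ))) *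
    F τ (z + (X.1 : ℂ) * τ + (X.2 : ℂ))

lemma wder_mul {f g : ℂ → ℂ} {w : ℂ} (hf : DifferentiableAt ℝ f w)
    (hg : DifferentiableAt ℝ g w) :
    wder (fun x => f x * g x) w = wder f w * g w + f w * wder g w := by
  have h : fderiv ℝ (fun x => f x * g x) w = f w • fderiv ℝ g w + g w • fderiv ℝ f w :=
    (hf.hasFDerivAt.mul hg.hasFDerivAt).fderiv
  simp only [wder, h, add_apply, smul_apply, smul_eq_mul]
  ring

lemma wder_add {f g : ℂ → ℂ} {w : ℂ} (hf : DifferentiableAt ℝ f w)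
    (hg : DifferentiableAt ℝ g w) :
    wder (fun x => f x + g x) w = wder f w + wder g w := by
  simp only [wder, (hf.hasFDerivAt.fun_add hg.hasFDerivAt).fderiv, add_apply]
  ring

lemma wder_const_mul {f : ℂ → ℂ} {w : ℂ} (c : ℂ) (hf : DifferentiableAt ℝ f w) :
    wder (fun x => c * f x) w = c * wder f w := by
  simp only [wder, (hf.hasFDerivAt.const_mul c).fderiv, smul_apply,
    smul_eq_mul]
  ring

/-- On holomorphic functions the Wirtinger derivative is the complex derivative. -/
lemma HasDerivAt.wder_eq {f : ℂ → ℂ} {f' w : ℂ} (h : HasDerivAt f f' w) : wder f w = f' := by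
  have h' := (h.hasFDerivAt.restrictScalars ℝ).fderiv
  simp only [wder, h', ContinuousLinearMap.coe_restrictScalars',
    ContinuousLinearMap.toSpanSingleton_apply, smul_eq_mul]
  linear_combination (-f' / 2) * Complex.I_sq

lemma wder_comp_add_const (f : ℂ → ℂ) (c w : ℂ) :
    wder (fun x => f (x + c)) w = wder f (w + c) := by
  simp only [wder, fderiv_comp_add_right]

lemma ContDiff.differentiable_wder {f : ℂ → ℂ} (hf : ContDiff ℝ 2 f) :
    Differentiable ℝ (wder f) := by
  have h : Differentiable ℝ (fderiv ℝ f) :=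
    (hf.fderiv_right (m := 1) (by norm_num)).differentiable (by norm_num)
  unfold wder
  fun_prop

/-- Chain rule for the Wirtinger derivative along the real-linear shear `w ↦ (w, z + l w + c)`. -/
lemma wder_comp_shear {F : ℂ → ℂ → ℂ} {τ z c : ℂ} (l : ℤ)
    (h : DifferentiableAt ℝ (fun p : ℂ × ℂ => F p.1 p.2) (τ, z + l * τ + c)) :
    DifferentiableAt ℝ (fun w => F w (z + l * w + c)) τ ∧
    wder (fun w => F w (z + l * w + c)) τ =
      wder (fun w => F w (z + l * τ + c)) τ + l * wder (F τ) (z + l * τ + c) := by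
  set D := fderiv ℝ (fun p : ℂ × ℂ => F p.1 p.2) (τ, z + l * τ + c) with hD
  have hid := hasFDerivAt_id (𝕜 := ℝ) τ
  have h1 : HasFDerivAt (fun w => F w (z + l * w + c)) _ τ :=
    HasFDerivAt.comp (f := fun w : ℂ => (w, z + l * w + c)) τ h.hasFDerivAt
      (hid.prodMk (((hid.const_mul (l : ℂ)).const_add z).add_const c))
  have h2 : HasFDerivAt (fun w => F w (z + l * τ + c)) _ τ :=
    HasFDerivAt.comp (f := fun w : ℂ => (w, z + l * τ + c)) τ h.hasFDerivAt
      (hid.prodMk (hasFDerivAt_const _ _))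
  have h3 : HasFDerivAt (F τ) _ (z + l * τ + c) :=
    HasFDerivAt.comp (f := fun w : ℂ => (τ, w)) (z + l * τ + c) h.hasFDerivAt
      ((hasFDerivAt_const _ _).prodMk (hasFDerivAt_id _))
  have key (v : ℂ) : D (v, l * v) = D (v, 0) + l * D (0, v) := by
    have : ((v, l * v) : ℂ × ℂ) = (v, 0) + l • ((0, v) : ℂ × ℂ) := by
      simp
    rw [this, map_add, map_zsmul, zsmul_eq_mul]
  refine ⟨h1.differentiableAt, ?_⟩
  simp only [wder, h1.fderiv, h2.fderiv, h3.fderiv, ← hD, ContinuousLinearMap.comp_apply,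
    ContinuousLinearMap.prod_apply, smul_apply, smul_eq_mul,
    ContinuousLinearMap.id_apply, zero_apply, key]
  ring

/-- The Wirtinger derivative of an exponential times a translate. -/
lemma wder_exp_mul_comp_add {f : ℂ → ℂ} (hf : Differentiable ℝ f) (a b c w : ℂ) :
    wder (fun x => exp (a * x + b) * f (x + c)) w =
      exp (a * w + b) * (a * f (w + c) + wder f (w + c)) := by
  have he : HasDerivAt (fun x => exp (a * x + b)) (exp (a * w + b) * (a * 1)) w :=
    (((hasDerivAt_id w).const_mul a).add_const b).cexp
  rw [wder_mul (he.differentiableAt.restrictScalars ℝ) (by fun_prop), he.wder_eq,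
    wder_comp_add_const]
  ring

lemma wder_wder_exp_mul_comp_add {f : ℂ → ℂ} (hf : ContDiff ℝ 2 f) (a b c w : ℂ) :
    wder (wder (fun x => exp (a * x + b) * f (x + c))) w =
      exp (a * w + b) *
        (a ^ 2 * f (w + c) + 2 * a * wder f (w + c) + wder (wder f) (w + c)) := by
  have hd : Differentiable ℝ f := hf.differentiable (by norm_num)
  have hw := hf.differentiable_wder
  rw [funext (wder_exp_mul_comp_add hd a b c),
    wder_exp_mul_comp_add (f := fun x => a * f x + wder f x) (by fun_prop) a b c w,
    wder_add (by fun_prop) (by fun_prop), wder_const_mul a (by fun_prop)]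
  ring

/-- for a twice continuously differentiable `F : ℍ×ℂ → ℂ` and
`X ∈ ℤ²`, the heat operator commutes with the elliptic slash action:
`H_m(F|_m X) = (H_m F)|_m X` on `ℍ × ℂ`. -/
theorem heatOp_comm_ellSlash (m : ℕ) (hm : 0 < m) (F : ℂ → ℂ → ℂ)
    (hF : ContDiffOn ℝ 2 (fun p : ℂ × ℂ => F p.1 p.2) {p : ℂ × ℂ | 0 < p.1.im})
    (X : ℤ × ℤ) (τ z : ℂ) (hτ : 0 < τ.im) :
    heatOp m (ellSlash m X F) τ z = ellSlash m X (heatOp m F) τ z := by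
  obtain ⟨l, n⟩ := X
  have hopen : IsOpen {p : ℂ × ℂ | 0 < p.1.im} :=
    isOpen_lt continuous_const (Complex.continuous_im.comp continuous_fst)
  have hFτ : ContDiff ℝ 2 (F τ) :=
    hF.comp_contDiff (f := fun w : ℂ => (τ, w)) (by fun_prop) fun _ => hτ
  have hdiff : DifferentiableAt ℝ (fun p : ℂ × ℂ => F p.1 p.2) (τ, z + l * τ + n) :=
    (hF.contDiffAt (hopen.mem_nhds hτ)).differentiableAt (by norm_num)
  obtain ⟨hshear, hwder⟩ := wder_comp_shear l hdiff
  set k : ℂ := 2 * (Real.pi : ℂ) * Complex.I * (m : ℂ) with hk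
  have he : HasDerivAt (fun w : ℂ => exp (k * ((l : ℂ) ^ 2 * w + 2 * l * z + n * l)))
      (exp (k * ((l : ℂ) ^ 2 * τ + 2 * l * z + n * l)) * (k * ((l : ℂ) ^ 2 * 1))) τ :=
    (((((hasDerivAt_id τ).const_mul _).add_const _).add_const _).const_mul k).cexp
  have hτder : wder (fun w => ellSlash m (l, n) F w z) τ = _ :=
    wder_mul (he.differentiableAt.restrictScalars ℝ) hshear
  have hslash : ellSlash m (l, n) F τ = fun x =>
      exp (2 * k * l * x + k * ((l : ℂ) ^ 2 * τ + n * l)) * F τ (x + (l * τ + n)) := by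
    funext x
    simp only [ellSlash, ← hk]
    ring_nf
  have hexp : 2 * k * l * z + k * ((l : ℂ) ^ 2 * τ + n * l) =
      k * ((l : ℂ) ^ 2 * τ + 2 * l * z + n * l) := by ring
  simp only [heatOp]
  rw [hτder, hslash, wder_wder_exp_mul_comp_add hFτ, he.wder_eq, hwder, hexp, ← add_assoc]
  simp only [ellSlash, heatOp, ← hk]
  rw [hk]
  ring
end
end

section
/- Let m be a positive integer and let F : ℍ×ℂ → ℂ be a function that is holomorphic in z for each fixed τ ∈ ℍ and satisfies F|_m X = F for every X ∈ ℤ². Then there exist uniquely determined functions f_a : ℍ → ℂ, indexed by a ∈ {0, 1/(2m), …, (2m−1)/(2m)}, such that F(τ,z) = Σ_a f_a(τ) θ_{m,a}(τ,z) for all (τ,z) ∈ ℍ×ℂ. -/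
open Complex UpperHalfPlane

noncomputable section

/-- The index-`m` theta series `θ_{m,a}`. -/
def theta (m : ℕ) (a : ℝ) (τ z : ℂ) : ℂ :=
  ∑' n : ℤ, Complex.exp (2 * (Real.pi : ℂ) * Complex.I * (m : ℂ) *
    (((n : ℂ) + (a : ℂ)) ^ 2 * τ + 2 * ((n : ℂ) + (a : ℂ)) * z))

/-- The integral over `[w, w + 1]` of a 1-periodic entire function does not depend on `w`. -/
theorem integral_add_eq_of_periodic {h : ℂ → ℂ} (hd : Differentiable ℂ h)
    (hp : Function.Periodic h 1) (w : ℂ) :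
    ∫ x in (0 : ℝ)..1, h (x + w) = ∫ x in (0 : ℝ)..1, h x := by
  obtain ⟨H, hH⟩ := hd.isExactOn_univ
  replace hH : ∀ z, HasDerivAt H (h z) z := fun z => hH z (Set.mem_univ z)
  have hint (w : ℂ) : ∫ x in (0 : ℝ)..1, h (x + w) = H (1 + w) - H w := by
    have key := intervalIntegral.integral_eq_sub_of_hasDerivAt
      (a := 0) (b := 1) (f := fun x : ℝ => H (x + w)) (f' := fun x : ℝ => h (x + w))
      (fun x _ => ((hH (x + w)).comp_add_const (x : ℂ) w).comp_ofReal)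
      ((hd.continuous.comp (by fun_prop)).intervalIntegrable _ _)
    simpa using key
  have hderiv (z : ℂ) : HasDerivAt (fun z => H (1 + z) - H z) 0 z := by
    simpa [add_comm (1 : ℂ), hp z] using ((hH (1 + z)).comp_const_add 1 z).fun_sub (hH z)
  have hconst := is_const_of_deriv_eq_zero (fun z => (hderiv z).differentiableAt)
    (fun z => (hderiv z).deriv)
  have h0 := hint 0
  simp only [add_zero] at h0
  rw [hint, h0]
  simpa using hconst w 0

/-- The `n`-th Fourier coefficient of a 1-periodic function of a complex variable. -/
def complexFourierCoeff (G : ℂ → ℂ) (n : ℤ) : ℂ :=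
  ∫ x in (0 : ℝ)..1, exp (-(2 * Real.pi * Complex.I * n * x)) * G x

theorem exp_neg_two_pi_mul_periodic (n : ℤ) :
    Function.Periodic (fun z : ℂ => exp (-(2 * Real.pi * Complex.I * n * z))) 1 := fun z => by
  dsimp only
  rw [show -(2 * Real.pi * Complex.I * n * (z + 1)) =
    -(2 * Real.pi * Complex.I * n * z) + ((-n : ℤ) : ℂ) * (2 * Real.pi * Complex.I) by push_cast; ring]
  exact exp_periodic.int_mul (-n) _

theorem complexFourierCoeff_eq_integral_add {G : ℂ → ℂ} (hd : Differentiable ℂ G)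
    (hp : Function.Periodic G 1) (n : ℤ) (w : ℂ) :
    complexFourierCoeff G n =
      ∫ x in (0 : ℝ)..1, exp (-(2 * Real.pi * Complex.I * n * (x + w))) * G (x + w) :=
  (integral_add_eq_of_periodic
    (h := fun z => exp (-(2 * Real.pi * Complex.I * n * z)) * G z) (by fun_prop)
    ((exp_neg_two_pi_mul_periodic n).mul hp) w).symm

theorem complexFourierCoeff_comp_add {G : ℂ → ℂ} (hd : Differentiable ℂ G)
    (hp : Function.Periodic G 1) (n : ℤ) (w : ℂ) :
    complexFourierCoeff (fun z => G (z + w)) n =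
      complexFourierCoeff G n * exp (2 * Real.pi * Complex.I * n * w) := by
  rw [complexFourierCoeff_eq_integral_add hd hp n w, ← intervalIntegral.integral_mul_const,
    complexFourierCoeff]
  refine intervalIntegral.integral_congr fun x _ => ?_
  rw [mul_right_comm _ (G _), ← exp_add]
  ring_nf

/-- The restriction of a continuous 1-periodic function to the circle `ℝ / ℤ`. -/
def circleRestrict (G : ℂ → ℂ) (hc : Continuous G) (hp : Function.Periodic G 1) :
    C(AddCircle (1 : ℝ), ℂ) where
  toFun := Function.Periodic.lift (f := fun x : ℝ => G x) (c := 1) fun x => by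
    simpa using hp x
  continuous_toFun := continuous_coinduced_dom.mpr (hc.comp continuous_ofReal)

theorem circleRestrict_coe (G : ℂ → ℂ) (hc : Continuous G) (hp : Function.Periodic G 1) (x : ℝ) :
    circleRestrict G hc hp (x : AddCircle (1 : ℝ)) = G x := rfl

theorem fourierCoeff_circleRestrict (G : ℂ → ℂ) (hc : Continuous G) (hp : Function.Periodic G 1)
    (n : ℤ) : fourierCoeff (circleRestrict G hc hp) n = complexFourierCoeff G n := by
  rw [fourierCoeff_eq_intervalIntegral _ n 0, complexFourierCoeff]
  simp only [circleRestrict_coe, fourier_coe_apply, smul_eq_mul]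
  simp

/-- An entire 1-periodic function is the sum of its Fourier series wherever that series converges
absolutely. -/
theorem hasSum_complexFourierCoeff {G : ℂ → ℂ} (hd : Differentiable ℂ G)
    (hp : Function.Periodic G 1) (z : ℂ)
    (hs : Summable fun n : ℤ => complexFourierCoeff G n * exp (2 * Real.pi * Complex.I * n * z)) :
    HasSum (fun n : ℤ => complexFourierCoeff G n * exp (2 * Real.pi * Complex.I * n * z)) (G z) := by
  have hc' : Continuous fun x => G (x + z) := hd.continuous.comp (by fun_prop)
  have hp' : Function.Periodic (fun x => G (x + z)) 1 := fun x => by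
    simpa [add_right_comm] using hp (x + z)
  have hcoeff : fourierCoeff (circleRestrict _ hc' hp') =
      fun n : ℤ => complexFourierCoeff G n * exp (2 * Real.pi * Complex.I * n * z) := by
    ext n
    rw [fourierCoeff_circleRestrict, complexFourierCoeff_comp_add hd hp]
  have key := has_pointwise_sum_fourier_series_of_summable (f := circleRestrict _ hc' hp')
    (by rwa [hcoeff]) ((0 : ℝ) : AddCircle (1 : ℝ))
  rw [hcoeff, circleRestrict_coe] at key
  simpa [fourier_coe_apply] using key

/-- The coefficients of an absolutely convergent Fourier series are the Fourier coefficients of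
its sum. -/
theorem eq_complexFourierCoeff_of_hasSum {G : ℂ → ℂ} (b : ℤ → ℂ) (hb : Summable b)
    (hG : ∀ x : ℝ, HasSum (fun n : ℤ => b n * exp (2 * Real.pi * Complex.I * n * x)) (G x)) (n : ℤ) :
    complexFourierCoeff G n = b n := by
  let F (k : ℤ) : AddCircle (1 : ℝ) → ℂ := fun x => fourier (-n) x • (b k • fourier k) x
  have hF (k : ℤ) : ∫ x, F k x ∂AddCircle.haarAddCircle = Pi.single (M := fun _ => ℂ) n (b n) k := by
    have h1 : ∫ x, F k x ∂AddCircle.haarAddCircle = fourierCoeff (T := 1) (b k • ⇑(fourier k)) n :=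
      rfl
    rw [h1, fourierCoeff.const_smul, fourierCoeff_fourier]
    rcases eq_or_ne k n with rfl | hk
    · simp
    · simp [hk, hk.symm]
  have hnorm (k : ℤ) (x : AddCircle (1 : ℝ)) : ‖F k x‖ = ‖b k‖ := by
    simp [F, fourier_apply, Circle.norm_coe]
  have hcont (k : ℤ) : Continuous (F k) := by fun_prop
  have key := MeasureTheory.hasSum_integral_of_summable_integral_norm
    (μ := AddCircle.haarAddCircle) (F := F)
    (fun k => (hcont k).integrable_of_hasCompactSupport (.of_compactSpace _))
    (by simpa [hnorm] using hb.norm)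
  simp only [hF] at key
  rw [← key.unique (hasSum_pi_single n (b n))]
  have h2 := fourierCoeff_eq_intervalIntegral (T := 1) (fun x => ∑' k, (b k • fourier k) x) n 0
  simp only [fourierCoeff, smul_eq_mul, ← tsum_mul_left] at h2
  simp only [F, smul_eq_mul, h2]
  rw [complexFourierCoeff]
  simp only [tsum_mul_left, ContinuousMap.smul_apply, smul_eq_mul, fourier_coe_apply, div_one,
    ofReal_one, zero_add, (hG _).tsum_eq]
  simp

theorem jacobiTheta₂_term_eq_mul (n : ℤ) (z τ : ℂ) :
    jacobiTheta₂_term n z τ = jacobiTheta₂_term n 0 τ * exp (2 * Real.pi * Complex.I * n * z) := by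
  simp only [jacobiTheta₂_term, ← exp_add]
  ring_nf

/-- A combination of the theta series `θ_{m,a}` is a single series over the integers whose
coefficients depend only on the residue class modulo `2m`. -/
theorem hasSum_sum_mul_theta (m : ℕ) [NeZero (2 * m)] (f : Fin (2 * m) → ℂ) {τ : ℂ}
    (hτ : 0 < τ.im) (z : ℂ) :
    HasSum (fun n : ℤ => f (Int.divModEquiv (2 * m) n).2 * jacobiTheta₂_term n z (τ / (2 * m)))
      (∑ a : Fin (2 * m), f a * theta m (((a : ℕ) : ℝ) / (2 * m)) τ z) := by
  have hm : (m : ℂ) ≠ 0 := by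
    have := NeZero.ne (2 * m)
    exact_mod_cast fun h : m = 0 => this (by simp [h])
  have hm' : (0 : ℝ) < m := lt_of_le_of_ne (by positivity) (by exact_mod_cast Ne.symm hm)
  have hτ' : 0 < (τ / (2 * m)).im := by
    rw [show (2 * m : ℂ) = ((2 * m : ℝ) : ℂ) by push_cast; rfl, div_ofReal_im]
    positivity
  have hJ := (summable_jacobiTheta₂_term_iff z (τ / (2 * m))).mpr hτ'
  have hs : Summable fun n : ℤ =>
      f (Int.divModEquiv (2 * m) n).2 * jacobiTheta₂_term n z (τ / (2 * m)) := by
    refine Summable.of_norm_bounded (hJ.norm.mul_left (∑ a, ‖f a‖)) fun n => ?_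
    rw [norm_mul]
    gcongr
    exact Finset.single_le_sum (f := fun a => ‖f a‖) (fun a _ => norm_nonneg _)
      (Finset.mem_univ _)
  have hs' := ((Int.divModEquiv (2 * m)).trans (Equiv.prodComm _ _)).symm.summable_iff.mpr hs
  have hsum := ((Int.divModEquiv (2 * m)).trans (Equiv.prodComm _ _)).symm.hasSum_iff.mp hs'.hasSum
  convert hsum using 1
  rw [hs'.tsum_prod, tsum_fintype]
  refine Finset.sum_congr rfl fun a _ => ?_
  rw [theta, ← tsum_mul_left]
  refine tsum_congr fun q => ?_
  have hq : (Int.divModEquiv (2 * m) ((Int.divModEquiv (2 * m)).symm (q, a))).2 = a :=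
    congrArg Prod.snd ((Int.divModEquiv (2 * m)).apply_symm_apply (q, a))
  simp only [Function.comp_apply, Equiv.symm_trans_apply, Equiv.prodComm_symm,
    Equiv.prodComm_apply, Prod.swap_prod_mk, hq]
  congr 1
  simp only [Int.divModEquiv, Equiv.coe_fn_symm_mk, jacobiTheta₂_term]
  push_cast
  congr 1
  field_simp
  ring

theorem apply_divModEquiv_snd {α : Type*} {N : ℕ} [NeZero N] {d : ℤ → α}
    (hd : Function.Periodic d N) (n : ℤ) : d ((Int.divModEquiv N n).2 : ℕ) = d n := by
  obtain ⟨⟨q, r⟩, rfl⟩ := (Int.divModEquiv N).symm.surjective n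
  rw [Equiv.apply_symm_apply]
  simp only [Int.divModEquiv, Equiv.coe_fn_symm_mk]
  rw [add_comm]
  exact (hd.int_mul q r).symm

/-- Invariance of `G` under the lattice translation by `τ` makes its normalised Fourier
coefficients periodic modulo `2m`. -/
theorem periodic_complexFourierCoeff_div {m : ℕ} (hm : 0 < m) {G : ℂ → ℂ} {τ : ℂ}
    (hd : Differentiable ℂ G) (hp : Function.Periodic G 1)
    (hG : ∀ z, exp (2 * Real.pi * Complex.I * m * (τ + 2 * z)) * G (z + τ) = G z) :
    Function.Periodic (fun n : ℤ => complexFourierCoeff G n / jacobiTheta₂_term n 0 (τ / (2 * m)))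
      ((2 * m : ℕ) : ℤ) := fun n => by
  have hm' : (m : ℂ) ≠ 0 := by exact_mod_cast hm.ne'
  have hcoeff : complexFourierCoeff G (n + (2 * m : ℕ)) =
      complexFourierCoeff G n * exp (2 * Real.pi * Complex.I * (n + m) * τ) := by
    rw [complexFourierCoeff_eq_integral_add hd hp n τ, ← intervalIntegral.integral_mul_const,
      complexFourierCoeff]
    refine intervalIntegral.integral_congr fun x _ => ?_
    rw [← hG x, ← mul_assoc, ← exp_add, mul_right_comm _ (G _), ← exp_add]
    congr 2
    push_cast
    ring
  have hJ : jacobiTheta₂_term (n + (2 * m : ℕ)) 0 (τ / (2 * m)) =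
      jacobiTheta₂_term n 0 (τ / (2 * m)) * exp (2 * Real.pi * Complex.I * (n + m) * τ) := by
    simp only [jacobiTheta₂_term, ← exp_add]
    congr 1
    push_cast
    field_simp
    ring
  dsimp only
  rw [hcoeff, hJ, mul_div_mul_right _ _ (exp_ne_zero _)]

/-- theta expansion: if `F : ℍ×ℂ → ℂ` is holomorphic in `z` for each
fixed `τ ∈ ℍ` and satisfies `F|_m X = F` for every `X ∈ ℤ²`, then there exist unique
functions `f_a : ℍ → ℂ`, `a ∈ {0, 1/(2m), …, (2m−1)/(2m)}`, with
`F(τ,z) = Σ_a f_a(τ) θ_{m,a}(τ,z)` on `ℍ × ℂ`. -/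
theorem theta_expansion (m : ℕ) (hm : 0 < m) (F : ℂ → ℂ → ℂ)
    (hhol : ∀ τ : ℂ, 0 < τ.im → Differentiable ℂ (F τ))
    (hinv : ∀ X : ℤ × ℤ, ∀ τ z : ℂ, 0 < τ.im → ellSlash m X F τ z = F τ z) :
    ∃! f : Fin (2 * m) → UpperHalfPlane → ℂ,
      ∀ (τ : UpperHalfPlane) (z : ℂ),
        F (τ : ℂ) z = ∑ a : Fin (2 * m), f a τ * theta m (((a : ℕ) : ℝ) / (2 * m)) (τ : ℂ) z := by
  have : NeZero (2 * m) := ⟨by omega⟩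
  have hp (τ : UpperHalfPlane) : Function.Periodic (F τ) 1 := fun z => by
    simpa [ellSlash] using hinv (0, 1) τ z τ.im_pos
  have hG (τ : UpperHalfPlane) (z : ℂ) :
      exp (2 * Real.pi * Complex.I * m * (τ + 2 * z)) * F τ (z + τ) = F τ z := by
    simpa [ellSlash] using hinv (1, 0) τ z τ.im_pos
  have hJ (τ : ℂ) (n : ℤ) : jacobiTheta₂_term n 0 τ ≠ 0 := exp_ne_zero _
  refine ⟨fun a τ => complexFourierCoeff (F τ) (a : ℕ) /
    jacobiTheta₂_term (a : ℕ) 0 ((τ : ℂ) / (2 * m)), fun τ z => ?_, fun f hf => ?_⟩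
  · have hsum := hasSum_sum_mul_theta m (fun a => complexFourierCoeff (F τ) (a : ℕ) /
      jacobiTheta₂_term (a : ℕ) 0 ((τ : ℂ) / (2 * m))) τ.im_pos z
    have hterm (n : ℤ) := apply_divModEquiv_snd
      (periodic_complexFourierCoeff_div hm (hhol τ τ.im_pos) (hp τ) (hG τ)) n
    simp only [hterm, jacobiTheta₂_term_eq_mul _ z, ← mul_assoc, div_mul_cancel₀ _ (hJ _ _)]
      at hsum
    exact (hasSum_complexFourierCoeff (hhol τ τ.im_pos) (hp τ) z hsum.summable).unique hsum
  · funext a τ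
    have hsum (z : ℂ) := hf τ z ▸ hasSum_sum_mul_theta m (f · τ) τ.im_pos z
    have hs := (hsum 0).summable
    rw [eq_complexFourierCoeff_of_hasSum _ hs (fun x => (hsum x).congr_fun fun n => by
      rw [jacobiTheta₂_term_eq_mul _ (x : ℂ), mul_assoc]), eq_div_iff (hJ _ _)]
    have ha : (Int.divModEquiv (2 * m) ((a : ℕ) : ℤ)).2 = a := by
      have := (Int.divModEquiv (2 * m)).apply_symm_apply (0, a)
      simpa [Int.divModEquiv] using congrArg Prod.snd this
    rw [ha]
end
end

section
/- Let k be an integer, m a positive integer, a ∈ (2m)⁻¹ℤ, and f : ℍ → ℂ a smooth function. Then the lowering operator intertwines with the theta expansion: ξ_{5/2−k,m}( f(τ) θ_{m,a}(τ,z) ) = conj( ξ_{2−k}(f)(τ) ) · θ_{m,a}(τ,z) for all (τ,z) ∈ ℍ×ℂ. -/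
open Complex

noncomputable section

/-- Anti-holomorphic Wirtinger derivative. -/
def wderBar (f : ℂ → ℂ) (w : ℂ) : ℂ :=
  (fderiv ℝ f w 1 + Complex.I * fderiv ℝ f w Complex.I) / 2

/-- `∂_τ̄` of a function of `(τ,z)`. -/
def pdTauBar (F : ℂ → ℂ → ℂ) (τ z : ℂ) : ℂ := wderBar (fun w => F w z) τ

/-- `∂_z̄` of a function of `(τ,z)`. -/
def pdZBar (F : ℂ → ℂ → ℂ) (τ z : ℂ) : ℂ := wderBar (F τ) z

/-- `∂_z̄∂_z̄` of a function of `(τ,z)`. -/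
def pdZBar2 (F : ℂ → ℂ → ℂ) (τ z : ℂ) : ℂ := wderBar (fun w => wderBar (F τ) w) z

/-- The operator `D_−^{(m)}`. -/
def Dminus (m : ℕ) (F : ℂ → ℂ → ℂ) (τ z : ℂ) : ℂ :=
  ((τ - (starRingEnd ℂ) τ) / (2 * Complex.I)) *
    (-(τ - (starRingEnd ℂ) τ) * pdTauBar F τ z
      - (z - (starRingEnd ℂ) z) * pdZBar F τ z
      + (1 / (4 * (Real.pi : ℂ) * (m : ℂ))) * ((τ - (starRingEnd ℂ) τ) / (2 * Complex.I))
          * pdZBar2 F τ z)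

/-- The lowering operator of weight `5/2 − k`:
`ξ_{5/2−k,m} = v^{(5/2−k)−5/2} D_−^{(m)} = v^{−k} D_−^{(m)}`. -/
def xiJacobi (k : ℤ) (m : ℕ) (F : ℂ → ℂ → ℂ) (τ z : ℂ) : ℂ :=
  ((τ.im : ℂ)) ^ (-k) * Dminus m F τ z

/-- The lowering operator `ξ_{2−k}(f) = 2i v^{2−k} conj(∂_τ̄ f)` on functions of `τ`. -/
def xiEll (k : ℤ) (f : ℂ → ℂ) (τ : ℂ) : ℂ :=
  2 * Complex.I * ((τ.im : ℂ)) ^ (2 - k) * (starRingEnd ℂ) (wderBar f τ)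

theorem theta_eq_exp_mul_jacobiTheta₂ (m : ℕ) (a : ℝ) (τ z : ℂ) :
    theta m a τ z =
      exp (2 * (Real.pi : ℂ) * I * (m : ℂ) * ((a : ℂ) ^ 2 * τ + 2 * (a : ℂ) * z)) *
        jacobiTheta₂ (2 * m * (a * τ + z)) (2 * m * τ) := by
  rw [theta, jacobiTheta₂, ← tsum_mul_left]
  refine tsum_congr fun n => ?_
  rw [jacobiTheta₂_term, ← exp_add]
  congr 1
  ring

theorem im_two_mul_natCast_mul_pos {m : ℕ} (hm : 0 < m) {τ : ℂ} (hτ : 0 < τ.im) :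
    0 < (2 * (m : ℂ) * τ).im := by
  have h : (2 * (m : ℂ) * τ).im = 2 * m * τ.im := by simp
  rw [h]
  positivity

theorem differentiableAt_theta_left {m : ℕ} (hm : 0 < m) (a : ℝ) {τ : ℂ} (hτ : 0 < τ.im)
    (z : ℂ) : DifferentiableAt ℂ (fun w => theta m a w z) τ := by
  simp only [theta_eq_exp_mul_jacobiTheta₂]
  refine DifferentiableAt.mul (by fun_prop) ?_
  exact (hasFDerivAt_jacobiTheta₂ (2 * m * (a * τ + z))
    (im_two_mul_natCast_mul_pos hm hτ)).differentiableAt.comp τ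
      (f := fun w : ℂ => (2 * (m : ℂ) * (a * w + z), 2 * (m : ℂ) * w)) (by fun_prop)

theorem differentiableAt_theta_right {m : ℕ} (hm : 0 < m) (a : ℝ) {τ : ℂ} (hτ : 0 < τ.im)
    (z : ℂ) : DifferentiableAt ℂ (theta m a τ) z := by
  rw [funext (theta_eq_exp_mul_jacobiTheta₂ m a τ)]
  refine DifferentiableAt.mul (by fun_prop) ?_
  exact (differentiableAt_jacobiTheta₂_fst (2 * m * (a * τ + z))
    (im_two_mul_natCast_mul_pos hm hτ)).comp z
      (f := fun y : ℂ => 2 * (m : ℂ) * (a * τ + y)) (by fun_prop)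

/-- The Cauchy-Riemann equation. -/
theorem DifferentiableAt.wderBar_eq_zero {f : ℂ → ℂ} {w : ℂ} (hf : DifferentiableAt ℂ f w) :
    wderBar f w = 0 := by
  have h : fderiv ℝ f w I = I * fderiv ℝ f w 1 := by
    rw [hf.fderiv_restrictScalars ℝ]
    simp
  rw [wderBar, h, ← mul_assoc, I_mul_I]
  ring

theorem wderBar_mul_of_differentiableAt {f g : ℂ → ℂ} {w : ℂ} (hf : DifferentiableAt ℝ f w)
    (hg : DifferentiableAt ℂ g w) :
    wderBar (fun y => f y * g y) w = wderBar f w * g w := by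
  have h := hg.wderBar_eq_zero
  rw [wderBar] at h
  rw [wderBar, fderiv_fun_mul hf (hg.restrictScalars ℝ)]
  simp only [add_apply, smul_apply, smul_eq_mul,
    wderBar]
  linear_combination f w * h

/-- the lowering operator intertwines with the theta expansion:
`ξ_{5/2−k,m}(f(τ)θ_{m,a}(τ,z)) = conj(ξ_{2−k}(f)(τ)) · θ_{m,a}(τ,z)` on `ℍ × ℂ`. -/
theorem xi_theta_expansion (k : ℤ) (m : ℕ) (hm : 0 < m) (a : ℝ)
    (ha : ∃ j : ℤ, a = (j : ℝ) / (2 * m)) (f : ℂ → ℂ)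
    (hf : ContDiffOn ℝ (⊤ : ℕ∞) f {τ : ℂ | 0 < τ.im}) (τ z : ℂ) (hτ : 0 < τ.im) :
    xiJacobi k m (fun w y => f w * theta m a w y) τ z =
      (starRingEnd ℂ) (xiEll k f τ) * theta m a τ z := by
  have hfd : DifferentiableAt ℝ f τ :=
    (hf.contDiffAt ((isOpen_lt continuous_const continuous_im).mem_nhds hτ)).differentiableAt
      (by simp)
  have hz (w : ℂ) : wderBar (fun y => f τ * theta m a τ y) w = 0 :=
    ((differentiableAt_theta_right hm a hτ w).const_mul (f τ)).wderBar_eq_zero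
  have hτbar : pdTauBar (fun w y => f w * theta m a w y) τ z = wderBar f τ * theta m a τ z :=
    wderBar_mul_of_differentiableAt hfd (differentiableAt_theta_left hm a hτ z)
  have hz2 : pdZBar2 (fun w y => f w * theta m a w y) τ z = 0 := by
    simp only [pdZBar2, hz]
    exact (differentiableAt_const 0).wderBar_eq_zero
  have hv : (τ.im : ℂ) ≠ 0 := ofReal_ne_zero.mpr hτ.ne'
  have him : τ - (starRingEnd ℂ) τ = 2 * I * (τ.im : ℂ) := by
    rw [sub_conj]; push_cast; ring
  rw [xiJacobi, Dminus, hτbar, hz2, pdZBar, hz, xiEll, him,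
    mul_div_cancel_left₀ _ (mul_ne_zero two_ne_zero I_ne_zero)]
  simp only [map_mul, map_zpow₀, conj_ofReal, conj_I, conj_conj, map_ofNat]
  rw [show (2 : ℤ) - k = -k + 2 by ring, zpow_add₀ hv, zpow_ofNat]
  ring
end
end

section
/- Let k ≥ 2 and m ≥ 1 be integers and let G : ℍ×ℂ → ℂ be jointly holomorphic. Then G satisfies G|_m X = G for all X ∈ ℤ² together with H_m^{k−1} G = 0 if and only if G(τ,z) = Σ_a g_a(τ) θ_{m,a}(τ,z), where a runs over {0, 1/(2m), …, (2m−1)/(2m)} and each g_a is a polynomial in τ of degree at most k−2. -/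
open Complex

noncomputable section

lemma wder_eq_deriv {f : ℂ → ℂ} {w : ℂ} (hf : DifferentiableAt ℂ f w) : wder f w = deriv f w := by
  have h := hf.fderiv_restrictScalars ℝ
  have h1 : fderiv ℝ f w 1 = deriv f w := by rw [h]; simp
  have h2 : fderiv ℝ f w I = I * deriv f w := by
    rw [h]
    simp [← toSpanSingleton_deriv]
  rw [wder, h1, h2, ← mul_assoc, I_mul_I]
  ring

/-- The partial weighted theta series `Σ_i r_i^p e(r_i z + r_i² τ / 2)`. -/
def weightedTheta {ι : Type*} (r : ι → ℤ) (p : ℕ) (z τ : ℂ) : ℂ :=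
  ∑' i, (r i : ℂ) ^ p * jacobiTheta₂_term (r i) z τ

lemma summable_weightedTheta_bound {ι : Type*} {r : ι → ℤ} (hr : Function.Injective r) (p : ℕ)
    (S : ℝ) {T : ℝ} (hT : 0 < T) :
    Summable fun i ↦ (|r i| ^ p : ℝ) * Real.exp (-Real.pi * (T * r i ^ 2 - 2 * S * |r i|)) :=
  (summable_pow_mul_jacobiTheta₂_term_bound S hT p).comp_injective hr

lemma norm_weightedTheta_term_le {S T : ℝ} (hT : 0 < T) {z τ : ℂ} (hz : |z.im| ≤ S)
    (hτ : T ≤ τ.im) (p : ℕ) (n : ℤ) :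
    ‖(n : ℂ) ^ p * jacobiTheta₂_term n z τ‖ ≤
      (|n| ^ p : ℝ) * Real.exp (-Real.pi * (T * n ^ 2 - 2 * S * |n|)) := by
  rw [norm_mul, norm_pow, norm_intCast]
  push_cast
  gcongr
  simpa using norm_jacobiTheta₂_term_le hT hz hτ n

lemma summable_weightedTheta {ι : Type*} {r : ι → ℤ} (hr : Function.Injective r) (p : ℕ) (z : ℂ)
    {τ : ℂ} (hτ : 0 < τ.im) :
    Summable fun i ↦ (r i : ℂ) ^ p * jacobiTheta₂_term (r i) z τ :=
  .of_norm_bounded (summable_weightedTheta_bound hr p |z.im| hτ)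
    fun i ↦ norm_weightedTheta_term_le hτ le_rfl le_rfl p (r i)

lemma hasDerivAt_weightedTheta_fst {ι : Type*} {r : ι → ℤ} (hr : Function.Injective r) (p : ℕ)
    (z : ℂ) {τ : ℂ} (hτ : 0 < τ.im) :
    HasDerivAt (fun w ↦ weightedTheta r p w τ)
      (2 * Real.pi * I * weightedTheta r (p + 1) z τ) z := by
  have hconv : Convex ℝ {w : ℂ | |w.im| < |z.im| + 1} := by
    have : {w : ℂ | |w.im| < |z.im| + 1} = imLm ⁻¹' Metric.ball 0 (|z.im| + 1) := by
      ext; simp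
    rw [this]
    exact (convex_ball _ _).linear_preimage _
  have key := hasDerivAt_tsum_of_isPreconnected
    (g := fun i w ↦ (r i : ℂ) ^ p * jacobiTheta₂_term (r i) w τ)
    (g' := fun i w ↦ 2 * Real.pi * I * ((r i : ℂ) ^ (p + 1) * jacobiTheta₂_term (r i) w τ))
    ((summable_weightedTheta_bound hr (p + 1) (|z.im| + 1) hτ).mul_left ‖2 * Real.pi * I‖)
    (isOpen_lt (by fun_prop) (by fun_prop)) hconv.isPreconnected
    (fun i w _ ↦ ?_) (fun i w hw ↦ ?_) (y₀ := z) (y := z) (by simp)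
    (summable_weightedTheta hr p z hτ) (by simp)
  · rwa [tsum_mul_left] at key
  · have : HasDerivAt (fun w ↦ 2 * Real.pi * I * r i * w + Real.pi * I * r i ^ 2 * τ)
        (2 * Real.pi * I * r i * 1) w := ((hasDerivAt_id w).const_mul _).add_const _
    refine (this.cexp.const_mul ((r i : ℂ) ^ p)).congr_deriv ?_
    rw [jacobiTheta₂_term]
    ring
  · rw [norm_mul]
    gcongr
    exact norm_weightedTheta_term_le hτ (le_of_lt hw) le_rfl (p + 1) (r i)

lemma hasDerivAt_weightedTheta_snd {ι : Type*} {r : ι → ℤ} (hr : Function.Injective r) (p : ℕ)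
    (z : ℂ) {τ : ℂ} (hτ : 0 < τ.im) :
    HasDerivAt (fun w ↦ weightedTheta r p z w)
      (Real.pi * I * weightedTheta r (p + 2) z τ) τ := by
  have key := hasDerivAt_tsum_of_isPreconnected
    (g := fun i w ↦ (r i : ℂ) ^ p * jacobiTheta₂_term (r i) z w)
    (g' := fun i w ↦ Real.pi * I * ((r i : ℂ) ^ (p + 2) * jacobiTheta₂_term (r i) z w))
    ((summable_weightedTheta_bound hr (p + 2) |z.im| (half_pos hτ)).mul_left ‖Real.pi * I‖)
    (isOpen_lt (by fun_prop) (by fun_prop)) (convex_halfSpace_im_gt (τ.im / 2)).isPreconnected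
    (fun i w _ ↦ ?_) (fun i w hw ↦ ?_) (y₀ := τ) (y := τ) (by simpa using hτ)
    (summable_weightedTheta hr p z hτ) (by simpa using hτ)
  · rwa [tsum_mul_left] at key
  · have : HasDerivAt (fun w ↦ 2 * Real.pi * I * r i * z + Real.pi * I * r i ^ 2 * w)
        (Real.pi * I * r i ^ 2 * 1) w := ((hasDerivAt_id w).const_mul _).const_add _
    refine (this.cexp.const_mul ((r i : ℂ) ^ p)).congr_deriv ?_
    rw [jacobiTheta₂_term]
    ring
  · rw [norm_mul]
    gcongr
    exact norm_weightedTheta_term_le (half_pos hτ) le_rfl (le_of_lt hw) (p + 2) (r i)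

/-- The integers congruent to `j` modulo `2m`, enumerated. -/
def residueIndex (m : ℕ) (j : ℤ) (n : ℤ) : ℤ := 2 * m * n + j

lemma residueIndex_injective {m : ℕ} (hm : 1 ≤ m) (j : ℤ) :
    Function.Injective (residueIndex m j) := by
  intro a b h
  simp only [residueIndex, add_left_inj] at h
  exact mul_left_cancel₀ (by positivity) h

lemma theta_eq_weightedTheta {m : ℕ} (hm : 1 ≤ m) (j : ℕ) (τ z : ℂ) :
    theta m ((j : ℝ) / (2 * m)) τ z = weightedTheta (residueIndex m j) 0 z (τ / (2 * m)) := by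
  have : (m : ℂ) ≠ 0 := by exact_mod_cast (by lia : m ≠ 0)
  refine tsum_congr fun n ↦ ?_
  rw [pow_zero, one_mul, jacobiTheta₂_term, residueIndex]
  congr 1
  push_cast
  field_simp
  ring

lemma im_div_two_mul_pos {m : ℕ} (hm : 1 ≤ m) {τ : ℂ} (hτ : 0 < τ.im) :
    0 < (τ / (2 * m)).im := by
  have : (2 * m : ℂ) = ((2 * m : ℝ) : ℂ) := by push_cast; rfl
  rw [this, div_ofReal_im]
  positivity

lemma heatOp_sum_mul_theta {m : ℕ} (hm : 1 ≤ m) {F : ℂ → ℂ → ℂ} (C : ℂ)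
    {h : Fin (2 * m) → ℂ → ℂ} (hh : ∀ a, DifferentiableOn ℂ (h a) {τ | 0 < τ.im})
    (hF : ∀ τ z : ℂ, 0 < τ.im →
      F τ z = C * ∑ a, h a τ * theta m (((a : ℕ) : ℝ) / (2 * m)) τ z) {τ : ℂ} (hτ : 0 < τ.im)
    (z : ℂ) :
    heatOp m F τ z = C * (8 * Real.pi * I * m) *
      ∑ a, deriv (h a) τ * theta m (((a : ℕ) : ℝ) / (2 * m)) τ z := by
  have hm0 : (m : ℂ) ≠ 0 := by exact_mod_cast (by lia : m ≠ 0)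
  have hopen : IsOpen {τ : ℂ | 0 < τ.im} := isOpen_lt (by fun_prop) (by fun_prop)
  have hτ' := im_div_two_mul_pos hm hτ
  simp_rw [theta_eq_weightedTheta hm] at hF ⊢
  set W : ℕ → ℕ → ℂ → ℂ → ℂ := fun j p ↦ weightedTheta (residueIndex m j) p
  have dz (a : Fin (2 * m)) (p : ℕ) (w : ℂ) : HasDerivAt (fun w ↦ W a p w (τ / (2 * m)))
      (2 * Real.pi * I * W a (p + 1) w (τ / (2 * m))) w :=
    hasDerivAt_weightedTheta_fst (residueIndex_injective hm a) p w hτ'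
  have hz (w : ℂ) : HasDerivAt (F τ)
      (C * ∑ a : Fin (2 * m), h a τ * (2 * Real.pi * I * W a 1 w (τ / (2 * m)))) w := by
    have : F τ = fun z ↦ C * ∑ a : Fin (2 * m), h a τ * W a 0 z (τ / (2 * m)) :=
      funext fun z ↦ hF τ z hτ
    rw [this]
    exact (HasDerivAt.fun_sum fun a _ ↦ (dz a 0 w).const_mul _).const_mul _
  have hz' : wder (F τ) =
      fun w ↦ C * ∑ a : Fin (2 * m), h a τ * (2 * Real.pi * I * W a 1 w (τ / (2 * m))) :=
    funext fun w ↦ by rw [wder_eq_deriv (hz w).differentiableAt, (hz w).deriv]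
  have hzz : HasDerivAt (wder (F τ)) (C * ∑ a : Fin (2 * m),
      h a τ * (2 * Real.pi * I * (2 * Real.pi * I * W a 2 z (τ / (2 * m))))) z := by
    rw [hz']
    exact (HasDerivAt.fun_sum fun a _ ↦ ((dz a 1 z).const_mul _).const_mul _).const_mul _
  have hdiv : HasDerivAt (fun w : ℂ ↦ w / (2 * m)) (1 / (2 * m)) τ :=
    (hasDerivAt_id τ).div_const _
  have ht : HasDerivAt (fun w ↦ F w z) (C * ∑ a : Fin (2 * m),
      (deriv (h a) τ * W a 0 z (τ / (2 * m)) +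
        h a τ * (Real.pi * I * W a 2 z (τ / (2 * m)) * (1 / (2 * m))))) τ := by
    have : (fun w ↦ F w z) =ᶠ[nhds τ]
        fun w ↦ C * ∑ a : Fin (2 * m), h a w * W a 0 z (w / (2 * m)) := by
      filter_upwards [hopen.mem_nhds hτ] with w hw using hF w z hw
    refine HasDerivAt.congr_of_eventuallyEq ?_ this
    exact (HasDerivAt.fun_sum fun a _ ↦
      ((hh a).differentiableAt (hopen.mem_nhds hτ)).hasDerivAt.mul
        ((hasDerivAt_weightedTheta_snd (residueIndex_injective hm a) 0 z hτ').comp τ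
          hdiv)).const_mul _
  rw [heatOp, wder_eq_deriv hzz.differentiableAt, hzz.deriv, wder_eq_deriv ht.differentiableAt,
    ht.deriv]
  simp only [Finset.mul_sum]
  rw [← Finset.sum_sub_distrib]
  refine Finset.sum_congr rfl fun a _ ↦ ?_
  field_simp
  ring

lemma iterate_heatOp_sum_mul_theta {m : ℕ} (hm : 1 ≤ m) (n : ℕ) {F : ℂ → ℂ → ℂ} (C : ℂ)
    {h : Fin (2 * m) → ℂ → ℂ} (hh : ∀ a, DifferentiableOn ℂ (h a) {τ | 0 < τ.im})
    (hF : ∀ τ z : ℂ, 0 < τ.im →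
      F τ z = C * ∑ a, h a τ * theta m (((a : ℕ) : ℝ) / (2 * m)) τ z) {τ : ℂ} (hτ : 0 < τ.im)
    (z : ℂ) :
    (heatOp m)^[n] F τ z = C * (8 * Real.pi * I * m) ^ n *
      ∑ a, iteratedDeriv n (h a) τ * theta m (((a : ℕ) : ℝ) / (2 * m)) τ z := by
  induction n generalizing F C h with
  | zero => simpa using hF τ z hτ
  | succ n ih =>
    have hopen : IsOpen {τ : ℂ | 0 < τ.im} := isOpen_lt (by fun_prop) (by fun_prop)
    rw [Function.iterate_succ_apply, ih (C * (8 * Real.pi * I * m)) (fun a ↦ (hh a).deriv hopen)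
      (fun τ z hτ ↦ heatOp_sum_mul_theta hm C hh hF hτ z)]
    simp only [iteratedDeriv_succ']
    ring

open MeasureTheory Set Filter Topology in
lemma differentiableOn_intervalIntegral_of_continuousOn {U : Set ℂ} (hU : IsOpen U)
    {f : ℂ → ℝ → ℂ} (hc : ContinuousOn (fun p : ℂ × ℝ ↦ f p.1 p.2) (U ×ˢ univ))
    (hd : ∀ x, DifferentiableOn ℂ (f · x) U) (a b : ℝ) :
    DifferentiableOn ℂ (fun τ ↦ ∫ x in a..b, f τ x) U := by
  intro τ₀ hτ₀
  have hcont {τ : ℂ} (hτ : τ ∈ U) : Continuous (f τ) :=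
    continuousOn_univ.mp <| hc.comp (f := fun x ↦ (τ, x)) (by fun_prop) fun x _ ↦ ⟨hτ, mem_univ x⟩
  obtain ⟨ε, hε, hball⟩ := Metric.nhds_basis_closedBall.mem_iff.mp (hU.mem_nhds hτ₀)
  have hsub {τ : ℂ} (hτ : τ ∈ Metric.ball τ₀ (ε / 2)) :
      Metric.closedBall τ (ε / 2) ⊆ Metric.closedBall τ₀ ε :=
    Metric.closedBall_subset_closedBall' (by rw [Metric.mem_ball] at hτ; linarith)
  obtain ⟨C, hC⟩ := ((isCompact_closedBall τ₀ ε).prod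
    (isCompact_uIcc (a := a) (b := b))).exists_bound_of_continuousOn
    (hc.mono (prod_mono hball (subset_univ _)))
  have hmeas : Measurable fun x ↦ deriv (f · x) τ₀ := by
    obtain ⟨u, -, hu, hu0⟩ := exists_seq_strictAnti_tendsto' hε
    refine measurable_of_tendsto_metrizable
      (f := fun (n : ℕ) x ↦ (u n : ℂ)⁻¹ * (f (τ₀ + u n) x - f τ₀ x)) (fun n ↦ ?_) ?_
    · have : τ₀ + u n ∈ U := hball (by
        simpa [abs_of_pos (hu n).1] using (hu n).2.le)
      exact (continuous_const.mul ((hcont this).sub (hcont hτ₀))).measurable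
    · rw [tendsto_pi_nhds]
      intro x
      refine ((hd x).differentiableAt (hU.mem_nhds hτ₀)).hasDerivAt.tendsto_slope_zero.comp ?_
      refine tendsto_nhdsWithin_iff.mpr ⟨?_, .of_forall fun n ↦ ?_⟩
      · exact_mod_cast (continuous_ofReal.tendsto 0).comp hu0
      · simpa using (hu n).1.ne'
  refine (intervalIntegral.hasDerivAt_integral_of_dominated_loc_of_deriv_le
    (F := f) (F' := fun τ x ↦ deriv (f · x) τ)
    (bound := fun _ ↦ C / (ε / 2)) (Metric.ball_mem_nhds τ₀ (half_pos hε)) ?_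
    ((hcont hτ₀).intervalIntegrable _ _) hmeas.aestronglyMeasurable
    (.of_forall fun x hx τ hτ ↦ ?_) intervalIntegrable_const
    (.of_forall fun x hx τ hτ ↦ ?_)).2.differentiableAt.differentiableWithinAt
  · filter_upwards [hU.mem_nhds hτ₀] with τ hτ using (hcont hτ).aestronglyMeasurable
  · refine norm_deriv_le_of_forall_mem_sphere_norm_le (half_pos hε) ?_ fun w hw ↦ ?_
    · refine ((hd x).mono ?_).diffContOnCl
      exact Metric.closure_ball_subset_closedBall.trans ((hsub hτ).trans hball)
    · exact hC (w, x) ⟨hsub hτ (Metric.sphere_subset_closedBall hw), uIoc_subset_uIcc hx⟩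
  · have : τ ∈ U := hball (hsub hτ (Metric.mem_closedBall_self (half_pos hε).le))
    exact ((hd x).differentiableAt (hU.mem_nhds this)).hasDerivAt

lemma exists_polynomial_of_iteratedDeriv_eq_zero {U : Set ℂ} (hU : IsOpen U)
    (hU' : IsPreconnected U) (n : ℕ) {f : ℂ → ℂ} (hf : DifferentiableOn ℂ f U)
    (h : ∀ z ∈ U, iteratedDeriv n f z = 0) :
    ∃ p : Polynomial ℂ, p.degree < n ∧ ∀ z ∈ U, f z = p.eval z := by
  induction n generalizing f with
  | zero => exact ⟨0, by simp, fun z hz ↦ by simpa using h z hz⟩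
  | succ n ih =>
    obtain ⟨p, hp, hfp⟩ := ih (hf.deriv hU) fun z hz ↦ by
      rw [← iteratedDeriv_succ']; exact h z hz
    let q : Polynomial ℂ :=
      ∑ i ∈ Finset.range n, Polynomial.monomial (i + 1) (p.coeff i / (i + 1))
    have hq : q.derivative = p := by
      ext i
      simp only [q, Polynomial.derivative_sum, Polynomial.derivative_monomial,
        Polynomial.finsetSum_coeff, Polynomial.coeff_monomial, add_tsub_cancel_right,
        Finset.sum_ite_eq', Finset.mem_range]
      split_ifs with hi
      · push_cast
        field_simp [Nat.cast_add_one_ne_zero (R := ℂ) i]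
      · exact (Polynomial.coeff_eq_zero_of_degree_lt
          (hp.trans_le (by exact_mod_cast not_lt.mp hi))).symm
    have hqdeg : q.degree < (n + 1 : ℕ) := by
      refine (Polynomial.degree_sum_le _ _).trans_lt ((Finset.sup_lt_iff (WithBot.bot_lt_coe _)).mpr
        fun i hi ↦ (Polynomial.degree_monomial_le _ _).trans_lt ?_)
      exact_mod_cast Nat.succ_lt_succ (Finset.mem_range.mp hi)
    obtain ⟨c, hc⟩ := hU.exists_is_const_of_deriv_eq_zero hU'
      (f := fun z ↦ f z - q.eval z) (hf.sub q.differentiable.differentiableOn) fun z hz ↦ by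
        rw [deriv_fun_sub (hf.differentiableAt (hU.mem_nhds hz)) q.differentiableAt,
          Polynomial.deriv, hq, hfp z hz]
        simp
    refine ⟨q + Polynomial.C c, ?_, fun z hz ↦ ?_⟩
    · exact (Polynomial.degree_add_le _ _).trans_lt (max_lt hqdeg
        (Polynomial.degree_C_le.trans_lt (by exact_mod_cast n.succ_pos)))
    · rw [Polynomial.eval_add, Polynomial.eval_C, ← hc z hz]
      ring

lemma iteratedDeriv_polynomial_eval (p : Polynomial ℂ) (n : ℕ) :
    iteratedDeriv n (fun z ↦ p.eval z) = fun z ↦ (Polynomial.derivative^[n] p).eval z := by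
  induction n generalizing p with
  | zero => rfl
  | succ n ih =>
    rw [iteratedDeriv_succ', Function.iterate_succ_apply, ← ih]
    congr 1
    ext z
    exact p.deriv

/-- Contour shift for an entire function of period `1`. -/
lemma intervalIntegral_add_eq_of_periodic {f : ℂ → ℂ} (hf : Differentiable ℂ f)
    (hp : Function.Periodic f 1) (w : ℂ) :
    ∫ x in (0 : ℝ)..1, f (x + w) = ∫ x in (0 : ℝ)..1, f x := by
  have hrect := integral_boundary_rect_eq_zero_of_differentiableOn f 0 (1 + w.im * I)
    hf.differentiableOn
  have hside (y : ℝ) : f (1 + y * I) = f (y * I) := by rw [add_comm, hp]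
  have hreal : Function.Periodic (fun x : ℝ ↦ f (x + w.im * I)) 1 := fun x ↦ by
    simp only [ofReal_add, ofReal_one]
    rw [add_right_comm, hp]
  have hre := hreal.intervalIntegral_add_eq w.re 0
  have hsub := intervalIntegral.integral_comp_add_right (a := 0) (b := 1)
    (fun x : ℝ ↦ f (x + w.im * I)) w.re
  simp at hrect
  simp only [hside] at hrect
  calc ∫ x in (0 : ℝ)..1, f (x + w) = ∫ x in (0 : ℝ)..1, f ((x + w.re : ℝ) + w.im * I) := by
        refine intervalIntegral.integral_congr fun x _ ↦ ?_
        simp only [ofReal_add]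
        rw [add_assoc, re_add_im]
    _ = ∫ x in (0 : ℝ)..1, f (x + w.im * I) := by
        rw [hsub, zero_add, add_comm 1 w.re, hre, zero_add]
    _ = ∫ x in (0 : ℝ)..1, f x := by
        linear_combination -hrect

/-- Fourier expansion of an entire function of period `1`. -/
lemma hasSum_fourier_of_periodic {f : ℂ → ℂ} (hf : Differentiable ℂ f)
    (hp : Function.Periodic f 1) (z : ℂ)
    (hs : Summable fun n : ℤ ↦
      (∫ x in (0 : ℝ)..1, exp (-(2 * Real.pi * I * n * x)) * f x) * exp (2 * Real.pi * I * n * z)) :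
    HasSum (fun n : ℤ ↦
      (∫ x in (0 : ℝ)..1, exp (-(2 * Real.pi * I * n * x)) * f x) * exp (2 * Real.pi * I * n * z))
      (f z) := by
  have : Fact ((0 : ℝ) < 1) := ⟨one_pos⟩
  have hper : Function.Periodic (fun x : ℝ ↦ f (x + z)) 1 := fun x ↦ by
    simp only [ofReal_add, ofReal_one]
    rw [add_right_comm, hp]
  let g : C(AddCircle (1 : ℝ), ℂ) := ⟨hper.lift, continuous_coinduced_dom.mpr
    (hf.continuous.comp (by fun_prop : Continuous fun x : ℝ ↦ (x : ℂ) + z))⟩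
  have hcoeff (n : ℤ) : fourierCoeff g n =
      (∫ x in (0 : ℝ)..1, exp (-(2 * Real.pi * I * n * x)) * f x) *
        exp (2 * Real.pi * I * n * z) := by
    have hexp : Function.Periodic (fun x : ℂ ↦ exp (-(2 * Real.pi * I * n * x)) * f x) 1 := by
      intro x
      simp only [hp x]
      congr 1
      rw [exp_eq_exp_iff_exists_int]
      exact ⟨-n, by push_cast; ring⟩
    rw [fourierCoeff_eq_intervalIntegral g n 0, ← intervalIntegral_add_eq_of_periodic
      (f := fun x ↦ exp (-(2 * Real.pi * I * n * x)) * f x) (by fun_prop) hexp z,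
      ← intervalIntegral.integral_mul_const]
    simp only [zero_add, div_one, one_smul]
    refine intervalIntegral.integral_congr fun x _ ↦ ?_
    simp only [fourier_coe_apply, smul_eq_mul]
    change _ * f (x + z) = _
    rw [mul_right_comm (exp _), ← exp_add]
    congr 2
    push_cast
    ring
  have := has_pointwise_sum_fourier_series_of_summable (f := g) (by rwa [funext hcoeff]) 0
  simp only [hcoeff] at this
  have h0 : g 0 = f z := by
    change hper.lift ((0 : ℝ) : AddCircle (1 : ℝ)) = f z
    rw [hper.lift_coe, ofReal_zero, zero_add]
  simpa [h0] using this

/-- Uniqueness of the coefficients of an absolutely convergent Fourier series. -/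
lemma eq_zero_of_tsum_fourier_eq_zero {c : ℤ → ℂ} (hc : Summable fun n ↦ ‖c n‖)
    (h : ∀ x : ℝ, ∑' n, c n * exp (2 * Real.pi * I * n * x) = 0) (n : ℤ) : c n = 0 := by
  have hnorm (k : ℤ) (x : ℝ) : ‖exp (2 * Real.pi * I * k * x)‖ = 1 := by
    rw [show 2 * Real.pi * I * k * x = ((2 * Real.pi * k * x : ℝ) : ℂ) * I by push_cast; ring,
      norm_exp_ofReal_mul_I]
  have hint (k : ℤ) : ∫ x in (0 : ℝ)..1, c k * exp (2 * Real.pi * I * (k - n : ℤ) * x) =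
      if k = n then c n else 0 := by
    split_ifs with hk
    · simp [hk]
    · have hne : 2 * Real.pi * I * (k - n : ℤ) ≠ 0 :=
        mul_ne_zero two_pi_I_ne_zero (by exact_mod_cast sub_ne_zero.mpr hk)
      rw [intervalIntegral.integral_const_mul, integral_exp_mul_complex hne]
      rw [ofReal_one, mul_one, mul_comm _ ((k - n : ℤ) : ℂ), exp_int_mul_two_pi_mul_I]
      simp
  have key := intervalIntegral.hasSum_integral_of_dominated_convergence (μ := MeasureTheory.volume)
    (a := 0) (b := 1) (F := fun k (x : ℝ) ↦ c k * exp (2 * Real.pi * I * (k - n : ℤ) * x))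
    (f := fun _ ↦ 0) (fun k _ ↦ ‖c k‖) (fun k ↦ by fun_prop)
    (fun k ↦ .of_forall fun x _ ↦ by rw [norm_mul, hnorm, mul_one]) (.of_forall fun x _ ↦ hc)
    intervalIntegrable_const (.of_forall fun x _ ↦ ?_)
  · simp only [hint, intervalIntegral.integral_zero] at key
    exact (hasSum_ite_eq n (c n)).unique key
  · have hsum : Summable fun k ↦ c k * exp (2 * Real.pi * I * k * x) :=
      .of_norm (by simpa only [norm_mul, hnorm, mul_one])
    have := (hsum.hasSum.mul_right (exp (-(2 * Real.pi * I * n * x))))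
    rw [h x, zero_mul] at this
    refine this.congr_fun fun k ↦ ?_
    rw [mul_assoc (c k), ← exp_add]
    congr 2
    push_cast
    ring

lemma residueIndex_eq_divModEquiv_symm {m : ℕ} [NeZero (2 * m)] (a : Fin (2 * m)) (n : ℤ) :
    residueIndex m a n = (Int.divModEquiv (2 * m)).symm (n, a) := by
  simp only [residueIndex, Int.divModEquiv_symm_apply]
  push_cast
  ring

lemma summable_mul_jacobiTheta₂_term {m : ℕ} (hm : 1 ≤ m) {b : ℤ → ℂ}
    (hb : ∀ (a : Fin (2 * m)) n, b (residueIndex m a n) = b a) (z : ℂ) {τ : ℂ} (hτ : 0 < τ.im) :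
    Summable fun n ↦ b n * jacobiTheta₂_term n z τ := by
  have : NeZero (2 * m) := ⟨by lia⟩
  refine .of_norm_bounded (((summable_jacobiTheta₂_term_iff z τ).mpr hτ).norm.mul_left
    (∑ a : Fin (2 * m), ‖b a‖)) fun n ↦ ?_
  obtain ⟨⟨q, a⟩, rfl⟩ := (Int.divModEquiv (2 * m)).symm.surjective n
  rw [norm_mul, ← residueIndex_eq_divModEquiv_symm, hb]
  gcongr
  exact Finset.single_le_sum (f := fun a : Fin (2 * m) ↦ ‖b a‖) (fun _ _ ↦ norm_nonneg _)
    (Finset.mem_univ a)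

/-- A combination of theta series, as a single theta series with coefficients depending only on
the residue modulo `2m`. -/
lemma sum_mul_theta_eq_tsum {m : ℕ} (hm : 1 ≤ m) {b : ℤ → ℂ}
    (hb : ∀ (a : Fin (2 * m)) n, b (residueIndex m a n) = b a) {τ : ℂ} (hτ : 0 < τ.im) (z : ℂ) :
    ∑ a : Fin (2 * m), b a * theta m (((a : ℕ) : ℝ) / (2 * m)) τ z =
      ∑' n, b n * jacobiTheta₂_term n z (τ / (2 * m)) := by
  have : NeZero (2 * m) := ⟨by lia⟩
  have hs := summable_mul_jacobiTheta₂_term hm hb z (im_div_two_mul_pos hm hτ)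
  let e : Fin (2 * m) × ℤ ≃ ℤ := (Equiv.prodComm _ _).trans (Int.divModEquiv (2 * m)).symm
  rw [← e.tsum_eq]
  refine Eq.trans ?_ (Summable.tsum_prod (e.summable_iff.mpr hs)).symm
  rw [tsum_fintype]
  refine Finset.sum_congr rfl fun a _ ↦ ?_
  rw [theta_eq_weightedTheta hm, weightedTheta, ← tsum_mul_left]
  refine tsum_congr fun n ↦ ?_
  have he : e (a, n) = residueIndex m a n := (residueIndex_eq_divModEquiv_symm a n).symm
  simp only [Function.comp_apply, he, hb, pow_zero, one_mul]

/-- The theta series of index `m` are linearly independent as functions of `z`. -/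
lemma eq_zero_of_sum_mul_theta_eq_zero {m : ℕ} (hm : 1 ≤ m) {b : Fin (2 * m) → ℂ} {τ : ℂ}
    (hτ : 0 < τ.im)
    (h : ∀ z, ∑ a : Fin (2 * m), b a * theta m (((a : ℕ) : ℝ) / (2 * m)) τ z = 0)
    (a : Fin (2 * m)) : b a = 0 := by
  have : NeZero (2 * m) := ⟨by lia⟩
  let B : ℤ → ℂ := fun n ↦ b (Int.divModEquiv (2 * m) n).2
  have hB (a : Fin (2 * m)) (n : ℤ) : B (residueIndex m a n) = b a := by
    simp only [B, residueIndex_eq_divModEquiv_symm, Equiv.apply_symm_apply]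
  have hBa (a : Fin (2 * m)) : B a = b a := by
    simpa [residueIndex] using hB a 0
  have hB' (a : Fin (2 * m)) (n : ℤ) : B (residueIndex m a n) = B a := by rw [hB, hBa]
  have hterm (n : ℤ) (x : ℂ) : B n * jacobiTheta₂_term n 0 (τ / (2 * m)) *
      exp (2 * Real.pi * I * n * x) = B n * jacobiTheta₂_term n x (τ / (2 * m)) := by
    rw [mul_assoc, jacobiTheta₂_term, ← exp_add, jacobiTheta₂_term]
    ring_nf
  have key := eq_zero_of_tsum_fourier_eq_zero
    (summable_mul_jacobiTheta₂_term hm hB' 0 (im_div_two_mul_pos hm hτ)).norm (fun x ↦ ?_) a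
  · rw [hBa] at key
    exact (mul_eq_zero.mp key).resolve_right (exp_ne_zero _)
  · simp only [hterm]
    rw [← sum_mul_theta_eq_tsum hm hB' hτ]
    simpa only [hBa] using h x

lemma ellSlash_theta {m : ℕ} (hm : 1 ≤ m) (j : ℕ) (X : ℤ × ℤ) (τ z : ℂ) :
    ellSlash m X (theta m ((j : ℝ) / (2 * m))) τ z = theta m ((j : ℝ) / (2 * m)) τ z := by
  have : (m : ℂ) ≠ 0 := by exact_mod_cast (by lia : m ≠ 0)
  rw [ellSlash, theta, theta, ← tsum_mul_left]
  refine (tsum_congr fun n ↦ ?_).trans ((Equiv.addRight X.1).tsum_eq _)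
  rw [← exp_add, exp_eq_exp_iff_exists_int]
  refine ⟨2 * m * n * X.2 + j * X.2 + m * X.1 * X.2, ?_⟩
  push_cast [Equiv.coe_addRight]
  field_simp
  ring

/-- The `n`-th coefficient in the theta expansion of index `m` of a function `G`. -/
def thetaCoeff (m : ℕ) (G : ℂ → ℂ → ℂ) (n : ℤ) (τ : ℂ) : ℂ :=
  exp (-(Real.pi * I * n ^ 2 * (τ / (2 * m)))) *
    ∫ x in (0 : ℝ)..1, exp (-(2 * Real.pi * I * n * x)) * G τ x

lemma differentiableOn_thetaCoeff (m : ℕ) {G : ℂ → ℂ → ℂ}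
    (hG : DifferentiableOn ℂ (fun p : ℂ × ℂ ↦ G p.1 p.2) {p : ℂ × ℂ | 0 < p.1.im}) (n : ℤ) :
    DifferentiableOn ℂ (thetaCoeff m G n) {τ | 0 < τ.im} := by
  refine DifferentiableOn.mul (by fun_prop) ?_
  refine differentiableOn_intervalIntegral_of_continuousOn
    (isOpen_lt (by fun_prop) (by fun_prop)) ?_ (fun x ↦ ?_) 0 1
  · refine ContinuousOn.mul (by fun_prop) ?_
    exact hG.continuousOn.comp (f := fun p : ℂ × ℝ ↦ (p.1, (p.2 : ℂ))) (by fun_prop)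
      fun p hp ↦ hp.1
  · refine DifferentiableOn.mul (by fun_prop) ?_
    exact hG.comp (f := fun τ : ℂ ↦ (τ, (x : ℂ))) (by fun_prop) fun τ hτ ↦ hτ

lemma thetaCoeff_add {m : ℕ} (hm : 1 ≤ m) {G : ℂ → ℂ → ℂ} {τ : ℂ}
    (hd : Differentiable ℂ (G τ)) (hp : Function.Periodic (G τ) 1)
    (hq : ∀ z, ellSlash m (1, 0) G τ z = G τ z) (n : ℤ) :
    thetaCoeff m G (n + 2 * m) τ = thetaCoeff m G n τ := by
  have hm0 : (m : ℂ) ≠ 0 := by exact_mod_cast (by lia : m ≠ 0)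
  have hper : Function.Periodic (fun x : ℂ ↦ exp (-(2 * Real.pi * I * n * x)) * G τ x) 1 := by
    intro x
    simp only [hp x]
    congr 1
    rw [exp_eq_exp_iff_exists_int]
    exact ⟨-n, by push_cast; ring⟩
  simp only [thetaCoeff]
  rw [← intervalIntegral_add_eq_of_periodic
    (f := fun x ↦ exp (-(2 * Real.pi * I * n * x)) * G τ x) (by fun_prop) hper τ,
    ← intervalIntegral.integral_const_mul, ← intervalIntegral.integral_const_mul]
  refine intervalIntegral.integral_congr fun x _ ↦ ?_
  have := hq x
  simp only [ellSlash, Int.cast_one, one_mul, Int.cast_zero, add_zero] at this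
  rw [← this, ← mul_assoc, ← mul_assoc, ← mul_assoc, ← exp_add, ← exp_add, ← exp_add]
  congr 2
  push_cast
  field_simp
  ring

/-- The theta decomposition. -/
lemma eq_sum_thetaCoeff_mul_theta {m : ℕ} (hm : 1 ≤ m) {G : ℂ → ℂ → ℂ} {τ : ℂ} (hτ : 0 < τ.im)
    (hd : Differentiable ℂ (G τ)) (h : ∀ X z, ellSlash m X G τ z = G τ z) (z : ℂ) :
    G τ z = ∑ a : Fin (2 * m), thetaCoeff m G a τ * theta m (((a : ℕ) : ℝ) / (2 * m)) τ z := by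
  have hp : Function.Periodic (G τ) 1 := fun z ↦ by simpa [ellSlash] using h (0, 1) z
  have hper : Function.Periodic (fun n ↦ thetaCoeff m G n τ) (2 * m : ℤ) := fun n ↦
    thetaCoeff_add hm hd hp (h (1, 0)) n
  have hb (a : Fin (2 * m)) (n : ℤ) :
      thetaCoeff m G (residueIndex m a n) τ = thetaCoeff m G a τ := by
    have := hper.int_mul n a
    rw [residueIndex, ← this]
    simp only [Int.cast_id]
    congr 1
    ring
  have hterm (n : ℤ) : (∫ x in (0 : ℝ)..1, exp (-(2 * Real.pi * I * n * x)) * G τ x) *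
      exp (2 * Real.pi * I * n * z) =
      thetaCoeff m G n τ * jacobiTheta₂_term n z (τ / (2 * m)) := by
    rw [thetaCoeff, jacobiTheta₂_term, mul_right_comm (exp _) _ (exp _), ← exp_add, mul_comm]
    congr 2
    ring
  have hs := summable_mul_jacobiTheta₂_term hm (b := fun n ↦ thetaCoeff m G n τ) hb z
    (im_div_two_mul_pos hm hτ)
  have key := hasSum_fourier_of_periodic hd hp z (by simpa only [hterm] using hs)
  simp only [hterm] at key
  rw [sum_mul_theta_eq_tsum hm (b := fun n ↦ thetaCoeff m G n τ) hb hτ, key.tsum_eq]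

/-- a jointly holomorphic `G : ℍ×ℂ → ℂ` satisfies `G|_m X = G` for all
`X ∈ ℤ²` and `H_m^{k−1} G = 0` if and only if
`G(τ,z) = Σ_a g_a(τ) θ_{m,a}(τ,z)` with each `g_a` a polynomial of degree ≤ `k−2`. -/
theorem mem_Pkm_iff_polynomial_theta (k m : ℕ) (hk : 2 ≤ k) (hm : 1 ≤ m)
    (G : ℂ → ℂ → ℂ)
    (hG : DifferentiableOn ℂ (fun p : ℂ × ℂ => G p.1 p.2) {p : ℂ × ℂ | 0 < p.1.im}) :
    ((∀ X : ℤ × ℤ, ∀ τ z : ℂ, 0 < τ.im → ellSlash m X G τ z = G τ z) ∧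
      (∀ τ z : ℂ, 0 < τ.im → (heatOp m)^[k - 1] G τ z = 0)) ↔
    (∃ g : Fin (2 * m) → Polynomial ℂ,
      (∀ a : Fin (2 * m), (g a).degree ≤ (k - 2 : ℕ)) ∧
      ∀ τ z : ℂ, 0 < τ.im →
        G τ z = ∑ a : Fin (2 * m),
          (g a).eval τ * theta m (((a : ℕ) : ℝ) / (2 * m)) τ z) := by
  have hopen : IsOpen {τ : ℂ | 0 < τ.im} := isOpen_lt (by fun_prop) (by fun_prop)
  constructor
  · rintro ⟨hslash, hheat⟩
    have hdec (τ z : ℂ) (hτ : 0 < τ.im) := eq_sum_thetaCoeff_mul_theta hm hτ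
      (fun z ↦ ((hG.differentiableAt ((hopen.preimage continuous_fst).mem_nhds hτ)).comp
        (f := fun z : ℂ ↦ (τ, z)) z (by fun_prop)))
      (fun X z ↦ hslash X τ z hτ) z
    have hzero (τ : ℂ) (hτ : 0 < τ.im) (a : Fin (2 * m)) :
        iteratedDeriv (k - 1) (thetaCoeff m G a) τ = 0 := by
      refine eq_zero_of_sum_mul_theta_eq_zero hm hτ
        (b := fun a ↦ iteratedDeriv (k - 1) (thetaCoeff m G a) τ) (fun z ↦ ?_) a
      have := hheat τ z hτ
      rw [iterate_heatOp_sum_mul_theta hm (k - 1) 1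
        (fun a : Fin (2 * m) ↦ differentiableOn_thetaCoeff m hG a)
        (fun τ z hτ ↦ by rw [one_mul]; exact hdec τ z hτ) hτ z] at this
      have hm0 : (m : ℂ) ≠ 0 := by exact_mod_cast (by lia : m ≠ 0)
      exact (mul_eq_zero.mp this).resolve_left (by simp [hm0, Real.pi_ne_zero])
    choose g hgdeg hg using fun a : Fin (2 * m) ↦ exists_polynomial_of_iteratedDeriv_eq_zero hopen
      (convex_halfSpace_im_gt 0).isPreconnected (k - 1) (differentiableOn_thetaCoeff m hG a)
      (fun τ hτ ↦ hzero τ hτ a)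
    refine ⟨g, fun a ↦ ?_, fun τ z hτ ↦ ?_⟩
    · rw [Polynomial.degree_le_iff_coeff_zero]
      intro n hn
      refine (Polynomial.degree_lt_iff_coeff_zero _ _).mp (hgdeg a) n ?_
      have : k - 2 < n := by exact_mod_cast hn
      lia
    · rw [hdec τ z hτ]
      exact Finset.sum_congr rfl fun a _ ↦ by rw [hg a τ hτ]
  · rintro ⟨g, hgdeg, hg⟩
    refine ⟨fun X τ z hτ ↦ ?_, fun τ z hτ ↦ ?_⟩
    · rw [hg τ z hτ, ellSlash, hg τ _ hτ, Finset.mul_sum]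
      refine Finset.sum_congr rfl fun a _ ↦ ?_
      rw [mul_left_comm]
      congr 1
      exact ellSlash_theta hm a X τ z
    · rw [iterate_heatOp_sum_mul_theta hm (k - 1) 1
        (fun a ↦ (g a).differentiable.differentiableOn)
        (fun τ z hτ ↦ by rw [one_mul]; exact hg τ z hτ) hτ z]
      have (a : Fin (2 * m)) : Polynomial.derivative^[k - 1] (g a) = 0 := by
        refine Polynomial.iterate_derivative_eq_zero ?_
        have := Polynomial.natDegree_le_of_degree_le (hgdeg a)
        lia
      simp [iteratedDeriv_polynomial_eval, this]
end
end

section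
/- Let m be a positive integer and a, b ∈ {0, 1/(2m), …, (2m−1)/(2m)}. For every τ = u+iv ∈ ℍ, the integral of θ_{m,a} against the conjugate of θ_{m,b} over a fundamental parallelogram of the lattice ℤτ+ℤ satisfies ∫_0^1 ∫_0^1 θ_{m,a}(τ, pτ+q) · conj(θ_{m,b}(τ, pτ+q)) · e^{−4πm p² v} · v dp dq = √(v/(4m)) · δ_{a,b}, where δ_{a,b} is the Kronecker delta. (In the coordinates z = x+iy = pτ+q this is the identity ∫_{ℂ/(ℤτ+ℤ)} θ_{m,a}(τ,z) conj(θ_{m,b}(τ,z)) e^{−4πm y²/v} dx dy = √(v/(4m)) δ_{a,b}.) -/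
open Complex MeasureTheory

noncomputable section

theorem integral_exp_two_pi_I_int_mul (k : ℤ) :
    ∫ q in (0:ℝ)..1, cexp (2 * Real.pi * I * k * q) = if k = 0 then 1 else 0 := by
  split_ifs with h
  · simp [h]
  · have hc : (2 * Real.pi * I * k : ℂ) ≠ 0 := by
      have : (k : ℂ) ≠ 0 := by exact_mod_cast h
      simp [Real.pi_ne_zero, this]
    rw [integral_exp_mul_complex hc]
    have : cexp (2 * Real.pi * I * k * (1:ℝ)) = 1 := by
      rw [← Complex.exp_int_mul_two_pi_mul_I k]
      congr 1
      push_cast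
      ring
    rw [this]
    simp

theorem norm_exp_two_pi_I_int_mul (k : ℤ) (q : ℝ) :
    ‖cexp (2 * Real.pi * I * k * q)‖ = 1 := by
  rw [Complex.norm_exp]
  simp

theorem conj_exp_two_pi_I_int_mul (k : ℤ) (q : ℝ) :
    (starRingEnd ℂ) (cexp (2 * Real.pi * I * k * q)) = cexp (2 * Real.pi * I * (-k : ℤ) * q) := by
  rw [← Complex.exp_conj]
  congr 1
  simp [map_ofNat]

/-- The `L²` pairing of two absolutely convergent trigonometric series. -/
theorem integral_tsum_mul_conj_tsum {A B : ℤ → ℂ} (hA : Summable fun n => ‖A n‖)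
    (hB : Summable fun n => ‖B n‖) (k l : ℤ → ℤ) :
    ∫ q in (0:ℝ)..1, (∑' n, A n * cexp (2 * Real.pi * I * k n * q)) *
        (starRingEnd ℂ) (∑' n, B n * cexp (2 * Real.pi * I * l n * q)) =
      ∑' x : ℤ × ℤ, if k x.1 = l x.2 then A x.1 * (starRingEnd ℂ) (B x.2) else 0 := by
  have hprod (q : ℝ) : HasSum (fun x : ℤ × ℤ => A x.1 * (starRingEnd ℂ) (B x.2) *
        cexp (2 * Real.pi * I * (k x.1 - l x.2 : ℤ) * q))
      ((∑' n, A n * cexp (2 * Real.pi * I * k n * q)) *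
        (starRingEnd ℂ) (∑' n, B n * cexp (2 * Real.pi * I * l n * q))) := by
    have h1 : Summable fun n => ‖A n * cexp (2 * Real.pi * I * k n * q)‖ := by
      simpa only [norm_mul, norm_exp_two_pi_I_int_mul, mul_one] using hA
    have h2 : Summable fun n => ‖(starRingEnd ℂ) (B n * cexp (2 * Real.pi * I * l n * q))‖ := by
      simpa only [RCLike.norm_conj, norm_mul, norm_exp_two_pi_I_int_mul, mul_one] using hB
    rw [Complex.conj_tsum, tsum_mul_tsum_of_summable_norm h1 h2]
    refine (congrArg (HasSum · _) (funext fun x => ?_)).mpr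
      (summable_mul_of_summable_norm h1 h2).hasSum
    rw [map_mul, conj_exp_two_pi_I_int_mul, mul_mul_mul_comm, ← Complex.exp_add]
    congr 2
    push_cast
    ring
  have hsum : Summable fun x : ℤ × ℤ => ‖A x.1 * (starRingEnd ℂ) (B x.2)‖ :=
    (hA.mul_norm (g := fun n => (starRingEnd ℂ) (B n)) (by simpa using hB))
  have key := intervalIntegral.hasSum_integral_of_dominated_convergence (μ := volume)
    (a := 0) (b := 1)
    (F := fun (x : ℤ × ℤ) (q : ℝ) => A x.1 * (starRingEnd ℂ) (B x.2) *
        cexp (2 * Real.pi * I * (k x.1 - l x.2 : ℤ) * q))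
    (fun x _ => ‖A x.1 * (starRingEnd ℂ) (B x.2)‖)
    (fun x => (by fun_prop : Continuous _).aestronglyMeasurable)
    (fun x => .of_forall fun q _ => by rw [norm_mul, norm_exp_two_pi_I_int_mul, mul_one])
    (.of_forall fun q _ => hsum) (by simp) (.of_forall fun q _ => hprod q)
  rw [← key.tsum_eq]
  refine tsum_congr fun x => ?_
  rw [intervalIntegral.integral_const_mul, integral_exp_two_pi_I_int_mul]
  simp [sub_eq_zero]

/-- Unfolding: the integral over the unit interval of the translates of a Gaussian. -/
theorem integral_tsum_gaussian {c : ℝ} (hc : 0 < c) (a : ℝ) :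
    ∫ p in (0:ℝ)..1, ∑' n : ℤ, Real.exp (-c * (p + n + a) ^ 2) = √(Real.pi / c) := by
  have hint : Integrable fun x : ℝ => Real.exp (-c * (x + a) ^ 2) :=
    (integrable_exp_neg_mul_sq hc).comp_add_right a
  have h := hint.hasSum_intervalIntegral_comp_add_int
  rw [integral_add_right_eq_self (fun x : ℝ => Real.exp (-c * x ^ 2)), integral_gaussian] at h
  rw [← h.tsum_eq]
  have hle : (0:ℝ) ≤ 1 := zero_le_one
  simp only [intervalIntegral.integral_of_le hle] at h ⊢
  refine (integral_tsum_of_summable_integral_norm (fun n => ?_) ?_).symm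
  · exact ((by fun_prop : Continuous fun p : ℝ => Real.exp (-c * (p + n + a) ^ 2)).integrableOn_Icc
      ).mono_set Set.Ioc_subset_Icc_self
  · simpa only [Real.norm_eq_abs, Real.abs_exp] using h.summable

/-- The value at `z` of the `n`-th term of `θ_{m,a}`. -/
def thetaTerm (m : ℕ) (a : ℝ) (τ z : ℂ) (n : ℤ) : ℂ :=
  cexp (2 * (Real.pi : ℂ) * I * (m : ℂ) *
    (((n : ℂ) + (a : ℂ)) ^ 2 * τ + 2 * ((n : ℂ) + (a : ℂ)) * z))

theorem summable_norm_thetaTerm {m : ℕ} (hm : 0 < m) (a : ℝ) {τ : ℂ} (hτ : 0 < τ.im) (z : ℂ) :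
    Summable fun n => ‖thetaTerm m a τ z n‖ := by
  have h : 0 < (((2 * m : ℝ) : ℂ) * τ).im := by
    rw [Complex.im_ofReal_mul]
    positivity
  have hs := (((summable_jacobiTheta₂_term_iff (2 * m * a * τ + 2 * m * z) _).mpr h).mul_left
    (cexp (2 * Real.pi * I * m * (a ^ 2 * τ + 2 * a * z)))).norm
  refine (summable_congr fun n => ?_).mp hs
  rw [jacobiTheta₂_term, ← Complex.exp_add, thetaTerm]
  congr 2
  push_cast
  ring

theorem theta_eq_tsum_mul_exp {m : ℕ} (hm : 0 < m) (j : ℕ) (τ z : ℂ) (q : ℝ) :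
    theta m ((j : ℝ) / (2 * m)) τ (z + q) = ∑' n, thetaTerm m ((j : ℝ) / (2 * m)) τ z n *
      cexp (2 * Real.pi * I * (2 * m * n + j : ℤ) * q) := by
  have hm' : (m : ℂ) ≠ 0 := by exact_mod_cast hm.ne'
  refine tsum_congr fun n => ?_
  rw [thetaTerm, ← Complex.exp_add]
  congr 1
  push_cast
  field_simp
  ring

theorem thetaTerm_mul_conj_self (m : ℕ) (a : ℝ) (τ : ℂ) (p : ℝ) (n : ℤ) :
    thetaTerm m a τ (p * τ) n * (starRingEnd ℂ) (thetaTerm m a τ (p * τ) n) *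
      (Real.exp (-(4 * Real.pi * m * p ^ 2 * τ.im)) : ℂ) =
      (Real.exp (-(4 * Real.pi * m * τ.im) * (p + n + a) ^ 2) : ℝ) := by
  rw [Complex.mul_conj', thetaTerm, Complex.norm_exp]
  have hre : (2 * (Real.pi : ℂ) * I * (m : ℂ) *
      (((n : ℂ) + (a : ℂ)) ^ 2 * τ + 2 * ((n : ℂ) + (a : ℂ)) * (p * τ))).re =
      -(2 * Real.pi * m * ((n + a) ^ 2 + 2 * (n + a) * p) * τ.im) := by
    have : 2 * (Real.pi : ℂ) * I * (m : ℂ) *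
      (((n : ℂ) + (a : ℂ)) ^ 2 * τ + 2 * ((n : ℂ) + (a : ℂ)) * (p * τ)) =
      ((2 * Real.pi * m * ((n + a) ^ 2 + 2 * (n + a) * p) : ℝ) : ℂ) * (I * τ) := by
      push_cast
      ring
    rw [this, Complex.re_ofReal_mul, Complex.I_mul_re]
    ring
  rw [hre]
  norm_cast
  rw [← Real.exp_nat_mul, ← Real.exp_add]
  congr 1
  push_cast
  ring

theorem integral_theta_mul_conj_theta {m : ℕ} (hm : 0 < m) {i j : ℕ} (hi : i < 2 * m)
    (hj : j < 2 * m) {τ : ℂ} (hτ : 0 < τ.im) (z : ℂ) :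
    ∫ q in (0:ℝ)..1, theta m ((i : ℝ) / (2 * m)) τ (z + q) *
        (starRingEnd ℂ) (theta m ((j : ℝ) / (2 * m)) τ (z + q)) =
      if i = j then ∑' n, thetaTerm m ((i : ℝ) / (2 * m)) τ z n *
        (starRingEnd ℂ) (thetaTerm m ((i : ℝ) / (2 * m)) τ z n) else 0 := by
  simp only [theta_eq_tsum_mul_exp hm]
  rw [integral_tsum_mul_conj_tsum (summable_norm_thetaTerm hm _ hτ z)
    (summable_norm_thetaTerm hm _ hτ z) (fun n => 2 * m * n + i) (fun n => 2 * m * n + j)]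
  have hm' : (2 * m : ℤ) ≠ 0 := by positivity
  split_ifs with h
  · subst h
    have hdiag : Function.Injective fun n : ℤ => (n, n) := fun _ _ h => (Prod.ext_iff.mp h).1
    rw [← hdiag.tsum_eq]
    · simp
    · rintro ⟨n, n'⟩ hx
      have : n = n' := by
        by_contra hne
        simp [hne, hm.ne'] at hx
      exact ⟨n, by simp [this]⟩
  · refine (tsum_congr fun x => if_neg fun hx => h ?_).trans tsum_zero
    have := congrArg (· % (2 * m : ℤ)) hx
    simp only [Int.mul_add_emod_self_left] at this
    rw [Int.emod_eq_of_lt (by positivity) (by exact_mod_cast hi),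
      Int.emod_eq_of_lt (by positivity) (by exact_mod_cast hj)] at this
    exact_mod_cast this

/-- orthogonality of theta series over a fundamental parallelogram:
for `a, b ∈ {0, 1/(2m), …, (2m−1)/(2m)}` and `τ ∈ ℍ` (writing `z = pτ + q`),
`∫_0^1 ∫_0^1 θ_{m,a}(τ,pτ+q) conj(θ_{m,b}(τ,pτ+q)) e^{−4πmp²v} v dp dq
  = √(v/(4m)) δ_{a,b}`. -/
theorem theta_orthogonality (m : ℕ) (hm : 0 < m) (a b : ℝ)
    (ha : ∃ j : ℕ, j < 2 * m ∧ a = (j : ℝ) / (2 * m))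
    (hb : ∃ j : ℕ, j < 2 * m ∧ b = (j : ℝ) / (2 * m))
    (τ : ℂ) (hτ : 0 < τ.im) :
    (∫ p in (0:ℝ)..1, ∫ q in (0:ℝ)..1,
        theta m a τ ((p : ℂ) * τ + (q : ℂ)) *
          (starRingEnd ℂ) (theta m b τ ((p : ℂ) * τ + (q : ℂ))) *
          (Real.exp (-(4 * Real.pi * (m : ℝ) * p ^ 2 * τ.im)) : ℂ) * (τ.im : ℂ)) =
      (Real.sqrt (τ.im / (4 * m)) : ℂ) * (if a = b then 1 else 0) := by
  obtain ⟨i, hi, rfl⟩ := ha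
  obtain ⟨j, hj, rfl⟩ := hb
  have hm' : (0:ℝ) < m := by exact_mod_cast hm
  have hij : (i : ℝ) / (2 * m) = (j : ℝ) / (2 * m) ↔ i = j := by
    rw [div_left_inj' (by positivity), Nat.cast_inj]
  simp only [intervalIntegral.integral_mul_const, integral_theta_mul_conj_theta hm hi hj hτ, hij]
  split_ifs with h
  · simp only [← tsum_mul_right, thetaTerm_mul_conj_self, ← Complex.ofReal_tsum,
      intervalIntegral.integral_ofReal]
    rw [integral_tsum_gaussian (by positivity), mul_one, ← Complex.ofReal_mul]
    congr 1
    have hv : τ.im = √(τ.im ^ 2) := (Real.sqrt_sq hτ.le).symm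
    nth_rewrite 2 [hv]
    rw [← Real.sqrt_mul (by positivity)]
    congr 1
    field_simp
  · simp
end
end

section
/- Let n ≥ 0 be an integer and let f be holomorphic on ℍ with |f(τ)| ≤ C e^{−c Im τ} for some constants C, c > 0. Then for all τ = u+iv ∈ ℍ the non-holomorphic Eichler integral satisfies ∂_τ̄ Ê_n(f)(τ) = −(−2iv)^n · conj(f(τ)); consequently ξ_{−n}(Ê_n(f))(τ) := 2i v^{−n} conj( ∂_τ̄ Ê_n(f)(τ) ) = −(2i)^{n+1} f(τ), so ξ_{−n} sends Ê_n(f) back to a nonzero constant multiple of f. -/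
open Complex MeasureTheory

noncomputable section

/-- The non-holomorphic Eichler integral
`Ê_n(f)(τ) = conj(∫_τ^{i∞} f(t)(t−τ̄)^n dt)`, the integral taken along the
vertical ray `t = τ + is`, `s ∈ (0,∞)`. -/
def Ehat (n : ℕ) (f : ℂ → ℂ) (τ : ℂ) : ℂ :=
  (starRingEnd ℂ)
    (∫ s in Set.Ioi (0:ℝ),
      f (τ + (s : ℂ) * Complex.I) *
        ((τ + (s : ℂ) * Complex.I) - (starRingEnd ℂ) τ) ^ n * Complex.I)

/-- A polynomial factor costs at most half of an exponential decay rate. -/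
lemma exists_exp_mul_pow_le (n : ℕ) {c K : ℝ} (hc : 0 < c) (hK : 0 ≤ K) :
    ∃ M : ℝ, ∀ s : ℝ, 0 ≤ s →
      Real.exp (-c * s) * (K + s) ^ n ≤ M * Real.exp (-(c / 2) * s) := by
  refine ⟨n.factorial * (2 / c) ^ n * Real.exp (c / 2 * K), fun s hs => ?_⟩
  have h := Real.pow_div_factorial_le_exp (c / 2 * (K + s)) (by positivity) n
  rw [div_le_iff₀ (by positivity)] at h
  have hpow : (K + s) ^ n = (2 / c) ^ n * (c / 2 * (K + s)) ^ n := by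
    rw [← mul_pow]
    congr 1
    field_simp
  calc Real.exp (-c * s) * (K + s) ^ n
      ≤ Real.exp (-c * s) *
          ((2 / c) ^ n * (Real.exp (c / 2 * (K + s)) * n.factorial)) := by
        rw [hpow]
        gcongr
    _ = n.factorial * (2 / c) ^ n * (Real.exp (-c * s) * Real.exp (c / 2 * (K + s))) := by ring
    _ = n.factorial * (2 / c) ^ n * (Real.exp (c / 2 * K) * Real.exp (-(c / 2) * s)) := by
        rw [← Real.exp_add, ← Real.exp_add]
        congr 2
        ring
    _ = _ := by ring

lemma integrableOn_exp_mul_pow (n : ℕ) {c K : ℝ} (hc : 0 < c) (hK : 0 ≤ K) :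
    IntegrableOn (fun s : ℝ => Real.exp (-c * s) * (K + s) ^ n) (Set.Ioi 0) := by
  obtain ⟨M, hM⟩ := exists_exp_mul_pow_le n hc hK
  refine Integrable.mono' ((exp_neg_integrableOn_Ioi 0 (half_pos hc)).const_mul M)
    (by fun_prop) ?_
  filter_upwards [ae_restrict_mem measurableSet_Ioi] with s (hs : 0 < s)
  rw [Real.norm_of_nonneg (by positivity)]
  exact hM s hs.le

lemma tendsto_exp_mul_pow (n : ℕ) {c K : ℝ} (hc : 0 < c) (hK : 0 ≤ K) :
    Filter.Tendsto (fun s : ℝ => Real.exp (-c * s) * (K + s) ^ n) Filter.atTop (nhds 0) := by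
  obtain ⟨M, hM⟩ := exists_exp_mul_pow_le n hc hK
  have hlim : Filter.Tendsto (fun s : ℝ => M * Real.exp (-(c / 2) * s))
      Filter.atTop (nhds 0) := by
    rw [← mul_zero M]
    exact (Real.tendsto_exp_atBot.comp
      (Filter.tendsto_id.const_mul_atTop_of_neg (by linarith))).const_mul M
  refine squeeze_zero' ?_ ?_ hlim
  · filter_upwards [Filter.eventually_ge_atTop 0] with s hs
    positivity
  · filter_upwards [Filter.eventually_ge_atTop 0] with s hs using hM s hs

/-- Cauchy's estimate, at a distance at least `r` from the real line. -/
lemma norm_deriv_le_of_exp_decay {f : ℂ → ℂ} {C c r : ℝ}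
    (hf : DifferentiableOn ℂ f {τ : ℂ | 0 < τ.im}) (hC : 0 < C) (hc : 0 < c) (hr : 0 < r)
    (hdecay : ∀ τ : ℂ, 0 < τ.im → ‖f τ‖ ≤ C * Real.exp (-c * τ.im))
    {z : ℂ} {s : ℝ} (hz : s + 2 * r ≤ z.im) (hs : 0 ≤ s) :
    ‖deriv f z‖ ≤ C / r * Real.exp (-c * s) := by
  have him : ∀ w ∈ Metric.closedBall z r, s + r ≤ w.im := fun w hw => by
    have h := (abs_le.mp ((Complex.abs_im_le_norm (w - z)).trans
      (by simpa [dist_eq_norm] using hw))).1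
    rw [Complex.sub_im] at h
    linarith
  have hball : DiffContOnCl ℂ f (Metric.ball z r) := by
    refine DifferentiableOn.diffContOnCl (hf.mono fun w hw => ?_)
    have := him w (Metric.closure_ball_subset_closedBall hw)
    show 0 < w.im
    linarith
  refine (Complex.norm_deriv_le_of_forall_mem_sphere_norm_le hr hball
    (C := C * Real.exp (-c * s)) fun w hw => ?_).trans_eq (by ring)
  have hw' := him w (Metric.sphere_subset_closedBall hw)
  refine (hdecay w (by linarith)).trans ?_
  gcongr ?_ * Real.exp ?_
  nlinarith

/-- The integrand of the Eichler integral at `x`, along the vertical ray from `x`. -/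
def eichlerIntegrand (n : ℕ) (f : ℂ → ℂ) (x : ℂ) (s : ℝ) : ℂ :=
  f (x + (s : ℂ) * Complex.I) *
    ((x + (s : ℂ) * Complex.I) - (starRingEnd ℂ) x) ^ n * Complex.I

/-- The real Fréchet derivative of `eichlerIntegrand` in the base point. -/
def eichlerIntegrandFDeriv (n : ℕ) (f : ℂ → ℂ) (x : ℂ) (s : ℝ) : ℂ →L[ℝ] ℂ :=
  (deriv f (x + (s : ℂ) * Complex.I) *
      ((x + (s : ℂ) * Complex.I) - (starRingEnd ℂ) x) ^ n * Complex.I) •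
    ContinuousLinearMap.id ℝ ℂ +
  (f (x + (s : ℂ) * Complex.I) *
      (n * ((x + (s : ℂ) * Complex.I) - (starRingEnd ℂ) x) ^ (n - 1)) * Complex.I) •
    (ContinuousLinearMap.id ℝ ℂ - (Complex.conjCLE : ℂ →L[ℝ] ℂ))

lemma im_add_ofReal_mul_I (x : ℂ) (s : ℝ) : (x + (s : ℂ) * Complex.I).im = x.im + s := by
  simp

lemma add_mul_I_sub_conj (x : ℂ) (s : ℝ) :
    (x + (s : ℂ) * Complex.I) - (starRingEnd ℂ) x = ((2 * x.im + s : ℝ) : ℂ) * Complex.I := by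
  apply Complex.ext <;> simp
  ring

lemma norm_add_mul_I_sub_conj {x : ℂ} {s : ℝ} (hx : 0 < x.im) (hs : 0 ≤ s) :
    ‖(x + (s : ℂ) * Complex.I) - (starRingEnd ℂ) x‖ = 2 * x.im + s := by
  rw [add_mul_I_sub_conj, norm_mul, Complex.norm_I, mul_one, Complex.norm_real,
    Real.norm_of_nonneg (by linarith)]

lemma isOpen_im_pos : IsOpen {τ : ℂ | 0 < τ.im} :=
  isOpen_lt continuous_const Complex.continuous_im

lemma hasFDerivAt_eichlerIntegrand (n : ℕ) {f : ℂ → ℂ}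
    (hf : DifferentiableOn ℂ f {τ : ℂ | 0 < τ.im}) {x : ℂ} {s : ℝ} (hx : 0 < x.im)
    (hs : 0 ≤ s) :
    HasFDerivAt (fun x => eichlerIntegrand n f x s) (eichlerIntegrandFDeriv n f x s) x := by
  have hz : 0 < (x + (s : ℂ) * Complex.I).im := by
    rw [im_add_ofReal_mul_I]
    linarith
  have hfz : HasDerivAt f _ _ := (hf.differentiableAt (isOpen_im_pos.mem_nhds hz)).hasDerivAt
  have hray : HasFDerivAt (fun x : ℂ => x + (s : ℂ) * Complex.I)
      (ContinuousLinearMap.id ℝ ℂ) x := (hasFDerivAt_id x).add_const _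
  have hconj : HasFDerivAt (fun x : ℂ => (starRingEnd ℂ) x)
      (Complex.conjCLE : ℂ →L[ℝ] ℂ) x := (Complex.conjCLE : ℂ →L[ℝ] ℂ).hasFDerivAt
  have h := (((hfz.hasFDerivAt.restrictScalars ℝ).comp x hray).mul
    ((hray.sub hconj).pow n)).mul_const Complex.I
  refine h.congr_fderiv ?_
  ext
  simp [eichlerIntegrandFDeriv]
  ring

lemma continuousOn_ray {g : ℂ → ℂ} (hg : ContinuousOn g {τ : ℂ | 0 < τ.im}) {x : ℂ}
    (hx : 0 < x.im) :
    ContinuousOn (fun s : ℝ => g (x + (s : ℂ) * Complex.I)) (Set.Ici 0) := by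
  refine hg.comp (by fun_prop) fun s (hs : 0 ≤ s) => ?_
  show 0 < (x + (s : ℂ) * Complex.I).im
  rw [im_add_ofReal_mul_I]
  linarith

lemma continuousOn_eichlerIntegrand (n : ℕ) {f : ℂ → ℂ}
    (hf : ContinuousOn f {τ : ℂ | 0 < τ.im}) {x : ℂ} (hx : 0 < x.im) :
    ContinuousOn (eichlerIntegrand n f x) (Set.Ici 0) :=
  ((continuousOn_ray hf hx).mul (by fun_prop)).mul continuousOn_const

lemma norm_eichlerIntegrand_le (n : ℕ) {f : ℂ → ℂ} {C c K : ℝ} {x : ℂ} {s : ℝ}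
    (hC : 0 < C) (hc : 0 < c)
    (hdecay : ∀ τ : ℂ, 0 < τ.im → ‖f τ‖ ≤ C * Real.exp (-c * τ.im))
    (hx : 0 < x.im) (hxK : 2 * x.im ≤ K) (hs : 0 ≤ s) :
    ‖eichlerIntegrand n f x s‖ ≤ C * (Real.exp (-c * s) * (K + s) ^ n) := by
  have hz := im_add_ofReal_mul_I x s
  have hfz : ‖f (x + (s : ℂ) * Complex.I)‖ ≤ C * Real.exp (-c * s) := by
    refine (hdecay _ (by linarith)).trans ?_
    gcongr ?_ * Real.exp ?_
    rw [hz]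
    nlinarith
  rw [eichlerIntegrand, norm_mul, norm_mul, Complex.norm_I, mul_one, norm_pow,
    norm_add_mul_I_sub_conj hx hs, ← mul_assoc]
  gcongr

lemma norm_eichlerIntegrandFDeriv_le (n : ℕ) {f : ℂ → ℂ} {C c r K : ℝ} {x : ℂ} {s : ℝ}
    (hf : DifferentiableOn ℂ f {τ : ℂ | 0 < τ.im}) (hC : 0 < C) (hc : 0 < c) (hr : 0 < r)
    (hdecay : ∀ τ : ℂ, 0 < τ.im → ‖f τ‖ ≤ C * Real.exp (-c * τ.im))
    (hx : 2 * r ≤ x.im) (hxK : 2 * x.im ≤ K) (hs : 0 ≤ s) :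
    ‖eichlerIntegrandFDeriv n f x s‖ ≤ C / r * (Real.exp (-c * s) * (K + s) ^ n) +
      C * n * 2 * (Real.exp (-c * s) * (K + s) ^ (n - 1)) := by
  have hx0 : 0 < x.im := by linarith
  have hz := im_add_ofReal_mul_I x s
  have hfz : ‖f (x + (s : ℂ) * Complex.I)‖ ≤ C * Real.exp (-c * s) := by
    refine (hdecay _ (by linarith)).trans ?_
    gcongr ?_ * Real.exp ?_
    rw [hz]
    nlinarith
  have hdz : ‖deriv f (x + (s : ℂ) * Complex.I)‖ ≤ C / r * Real.exp (-c * s) :=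
    norm_deriv_le_of_exp_decay hf hC hc hr hdecay (by linarith) hs
  have hid : ‖ContinuousLinearMap.id ℝ ℂ‖ ≤ 1 := ContinuousLinearMap.norm_id_le
  have hconj : ‖(Complex.conjCLE : ℂ →L[ℝ] ℂ)‖ ≤ 1 :=
    ContinuousLinearMap.opNorm_le_bound _ zero_le_one fun z => by simp
  have hsub : ‖ContinuousLinearMap.id ℝ ℂ - (Complex.conjCLE : ℂ →L[ℝ] ℂ)‖ ≤ 2 :=
    (norm_sub_le _ _).trans (by linarith)
  have hKs : 0 ≤ K + s := by linarith
  refine (norm_add_le _ _).trans (add_le_add ?_ ?_)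
  · rw [norm_smul, norm_mul, norm_mul, Complex.norm_I, mul_one, norm_pow,
      norm_add_mul_I_sub_conj hx0 hs]
    calc _ ≤ C / r * Real.exp (-c * s) * (K + s) ^ n * 1 := by gcongr
      _ = _ := by ring
  · rw [norm_smul, norm_mul, norm_mul, norm_mul, Complex.norm_I, mul_one, norm_pow,
      norm_add_mul_I_sub_conj hx0 hs, Complex.norm_natCast]
    calc _ ≤ C * Real.exp (-c * s) * (n * (K + s) ^ (n - 1)) * 2 := by gcongr
      _ = _ := by ring

lemma continuousOn_eichlerIntegrandFDeriv (n : ℕ) {f : ℂ → ℂ}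
    (hf : DifferentiableOn ℂ f {τ : ℂ | 0 < τ.im}) {x : ℂ} (hx : 0 < x.im) :
    ContinuousOn (eichlerIntegrandFDeriv n f x) (Set.Ici 0) := by
  have hf' := continuousOn_ray hf.continuousOn hx
  have hd := continuousOn_ray (hf.deriv isOpen_im_pos).continuousOn hx
  exact (((hd.mul (by fun_prop)).mul continuousOn_const).smul continuousOn_const).add
    (((hf'.mul (by fun_prop)).mul continuousOn_const).smul continuousOn_const)

lemma integrable_eichlerIntegrandFDeriv_and_hasFDerivAt (n : ℕ) {f : ℂ → ℂ} {C c : ℝ}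
    (hf : DifferentiableOn ℂ f {τ : ℂ | 0 < τ.im}) (hC : 0 < C) (hc : 0 < c)
    (hdecay : ∀ τ : ℂ, 0 < τ.im → ‖f τ‖ ≤ C * Real.exp (-c * τ.im))
    {τ : ℂ} (hτ : 0 < τ.im) :
    IntegrableOn (eichlerIntegrandFDeriv n f τ) (Set.Ioi 0) ∧
      HasFDerivAt (fun x => ∫ s in Set.Ioi (0 : ℝ), eichlerIntegrand n f x s)
        (∫ s in Set.Ioi (0 : ℝ), eichlerIntegrandFDeriv n f τ s) τ := by
  have hK : 0 ≤ 3 * τ.im := by linarith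
  have him : ∀ x ∈ Metric.ball τ (τ.im / 2), τ.im / 2 ≤ x.im ∧ 2 * x.im ≤ 3 * τ.im := by
    intro x hx
    rw [Metric.mem_ball, dist_eq_norm] at hx
    have h := abs_le.mp ((Complex.abs_im_le_norm (x - τ)).trans hx.le)
    rw [Complex.sub_im] at h
    constructor <;> linarith [h.1, h.2]
  have hmeas : AEStronglyMeasurable (eichlerIntegrandFDeriv n f τ)
      (volume.restrict (Set.Ioi 0)) :=
    ((continuousOn_eichlerIntegrandFDeriv n hf hτ).mono
      Set.Ioi_subset_Ici_self).aestronglyMeasurable measurableSet_Ioi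
  have hmeas' : ∀ x ∈ Metric.ball τ (τ.im / 2),
      AEStronglyMeasurable (eichlerIntegrand n f x) (volume.restrict (Set.Ioi 0)) :=
    fun x hx => ((continuousOn_eichlerIntegrand n hf.continuousOn
      (by linarith [(him x hx).1])).mono
        Set.Ioi_subset_Ici_self).aestronglyMeasurable measurableSet_Ioi
  have hbound : IntegrableOn (fun s : ℝ =>
      C / (τ.im / 4) * (Real.exp (-c * s) * (3 * τ.im + s) ^ n) +
        C * n * 2 * (Real.exp (-c * s) * (3 * τ.im + s) ^ (n - 1))) (Set.Ioi 0) :=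
    ((integrableOn_exp_mul_pow n hc hK).const_mul _).add
      ((integrableOn_exp_mul_pow (n - 1) hc hK).const_mul _)
  have hle : ∀ᵐ s ∂(volume.restrict (Set.Ioi (0 : ℝ))), ∀ x ∈ Metric.ball τ (τ.im / 2),
      ‖eichlerIntegrandFDeriv n f x s‖ ≤
        C / (τ.im / 4) * (Real.exp (-c * s) * (3 * τ.im + s) ^ n) +
          C * n * 2 * (Real.exp (-c * s) * (3 * τ.im + s) ^ (n - 1)) := by
    filter_upwards [ae_restrict_mem measurableSet_Ioi] with s (hs : 0 < s) x hx
    exact norm_eichlerIntegrandFDeriv_le n hf hC hc (by linarith) hdecay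
      (by linarith [(him x hx).1]) (him x hx).2 hs.le
  have hτball : τ ∈ Metric.ball τ (τ.im / 2) := Metric.mem_ball_self (by linarith)
  have hint : IntegrableOn (eichlerIntegrand n f τ) (Set.Ioi 0) := by
    refine Integrable.mono' ((integrableOn_exp_mul_pow n hc hK).const_mul C)
      (hmeas' τ hτball) ?_
    filter_upwards [ae_restrict_mem measurableSet_Ioi] with s (hs : 0 < s)
    exact norm_eichlerIntegrand_le n hC hc hdecay hτ (by linarith) hs.le
  refine ⟨Integrable.mono' hbound hmeas (hle.mono fun s h => h τ hτball), ?_⟩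
  refine hasFDerivAt_integral_of_dominated_of_fderiv_le (Metric.ball_mem_nhds τ (half_pos hτ))
    ?_ hint hmeas hle hbound ?_
  · filter_upwards [Metric.ball_mem_nhds τ (half_pos hτ)] with x hx using hmeas' x hx
  · filter_upwards [ae_restrict_mem measurableSet_Ioi] with s (hs : 0 < s) x hx
    exact hasFDerivAt_eichlerIntegrand n hf (by linarith [(him x hx).1]) hs.le

lemma eichlerIntegrandFDeriv_wirtinger (n : ℕ) (f : ℂ → ℂ) (x : ℂ) (s : ℝ) :
    (eichlerIntegrandFDeriv n f x s 1 -
        Complex.I * eichlerIntegrandFDeriv n f x s Complex.I) / 2 =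
      (deriv f (x + (s : ℂ) * Complex.I) *
          ((x + (s : ℂ) * Complex.I) - (starRingEnd ℂ) x) ^ n +
        f (x + (s : ℂ) * Complex.I) *
          (n * ((x + (s : ℂ) * Complex.I) - (starRingEnd ℂ) x) ^ (n - 1))) * Complex.I := by
  simp [eichlerIntegrandFDeriv]
  linear_combination (-(1 / 2) * (deriv f (x + (s : ℂ) * Complex.I) *
          ((x + (s : ℂ) * Complex.I) - (starRingEnd ℂ) x) ^ n +
        2 * f (x + (s : ℂ) * Complex.I) *
          (n * ((x + (s : ℂ) * Complex.I) - (starRingEnd ℂ) x) ^ (n - 1))) * Complex.I) *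
    Complex.I_mul_I

/-- The holomorphic Wirtinger derivative of the Eichler integrand is a derivative along the
ray. -/
lemma hasDerivAt_ray (n : ℕ) {f : ℂ → ℂ} (hf : DifferentiableOn ℂ f {τ : ℂ | 0 < τ.im})
    {x : ℂ} {s : ℝ} (hx : 0 < x.im) (hs : 0 ≤ s) :
    HasDerivAt (fun s : ℝ => f (x + (s : ℂ) * Complex.I) *
        ((x + (s : ℂ) * Complex.I) - (starRingEnd ℂ) x) ^ n)
      ((eichlerIntegrandFDeriv n f x s 1 -
        Complex.I * eichlerIntegrandFDeriv n f x s Complex.I) / 2) s := by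
  have hz : 0 < (x + (s : ℂ) * Complex.I).im := by
    rw [im_add_ofReal_mul_I]
    linarith
  have hfz : HasDerivAt f _ _ := (hf.differentiableAt (isOpen_im_pos.mem_nhds hz)).hasDerivAt
  have hray : HasDerivAt (fun s : ℝ => x + (s : ℂ) * Complex.I) Complex.I s := by
    simpa using ((Complex.ofRealCLM.hasDerivAt (x := s)).mul_const Complex.I).const_add x
  rw [eichlerIntegrandFDeriv_wirtinger]
  refine ((hfz.comp s hray).mul ((hray.sub_const _).pow n)).congr_deriv ?_
  simp only [Function.comp_apply, Pi.pow_apply]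
  ring

lemma tendsto_ray (n : ℕ) {f : ℂ → ℂ} {C c : ℝ} (hC : 0 < C) (hc : 0 < c)
    (hdecay : ∀ τ : ℂ, 0 < τ.im → ‖f τ‖ ≤ C * Real.exp (-c * τ.im))
    {τ : ℂ} (hτ : 0 < τ.im) :
    Filter.Tendsto (fun s : ℝ => f (τ + (s : ℂ) * Complex.I) *
        ((τ + (s : ℂ) * Complex.I) - (starRingEnd ℂ) τ) ^ n) Filter.atTop (nhds 0) := by
  have hlim := (tendsto_exp_mul_pow n hc (K := 2 * τ.im) (by linarith)).const_mul C
  rw [mul_zero] at hlim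
  refine squeeze_zero_norm' ?_ hlim
  filter_upwards [Filter.eventually_ge_atTop 0] with s hs
  have h := norm_eichlerIntegrand_le n hC hc hdecay hτ le_rfl hs
  rwa [eichlerIntegrand, norm_mul, Complex.norm_I, mul_one] at h

lemma wderBar_Ehat (n : ℕ) {f : ℂ → ℂ} {C c : ℝ}
    (hf : DifferentiableOn ℂ f {τ : ℂ | 0 < τ.im}) (hC : 0 < C) (hc : 0 < c)
    (hdecay : ∀ τ : ℂ, 0 < τ.im → ‖f τ‖ ≤ C * Real.exp (-c * τ.im))
    {τ : ℂ} (hτ : 0 < τ.im) :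
    wderBar (Ehat n f) τ =
      (starRingEnd ℂ) (-(f τ * (2 * Complex.I * (τ.im : ℂ)) ^ n)) := by
  obtain ⟨hint, hder⟩ :=
    integrable_eichlerIntegrandFDeriv_and_hasFDerivAt n hf hC hc hdecay hτ
  have hE : HasFDerivAt (Ehat n f) _ τ :=
    (Complex.conjCLE : ℂ →L[ℝ] ℂ).hasFDerivAt.comp τ hder
  have hint1 := hint.apply_continuousLinearMap 1
  have hintI := hint.apply_continuousLinearMap Complex.I
  have hcont : ContinuousWithinAt (fun s : ℝ => f (τ + (s : ℂ) * Complex.I) *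
      ((τ + (s : ℂ) * Complex.I) - (starRingEnd ℂ) τ) ^ n) (Set.Ici 0) 0 :=
    (hasDerivAt_ray n hf hτ le_rfl).continuousAt.continuousWithinAt
  have hFTC := integral_Ioi_of_hasDerivAt_of_tendsto hcont
    (fun s (hs : 0 < s) => hasDerivAt_ray n hf hτ hs.le)
    ((hint1.sub (hintI.const_mul Complex.I)).div_const 2) (tendsto_ray n hC hc hdecay hτ)
  rw [integral_div, integral_sub hint1 (hintI.const_mul Complex.I), integral_const_mul,
    ← ContinuousLinearMap.integral_apply hint, ← ContinuousLinearMap.integral_apply hint,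
    add_mul_I_sub_conj] at hFTC
  rw [wderBar, hE.fderiv]
  have hval : -(f τ * (2 * Complex.I * (τ.im : ℂ)) ^ n) = 0 - f (τ + ((0 : ℝ) : ℂ) * Complex.I) *
      (((2 * τ.im + 0 : ℝ) : ℂ) * Complex.I) ^ n := by
    push_cast
    ring_nf
  rw [hval, ← hFTC]
  simp [map_ofNat (starRingEnd ℂ) 2]

/-- for `f` holomorphic on `ℍ` with exponential decay,
`∂_τ̄ Ê_n(f)(τ) = −(−2iv)^n conj(f(τ))`, and consequently
`ξ_{−n}(Ê_n(f))(τ) = 2i v^{−n} conj(∂_τ̄ Ê_n(f)(τ)) = −(2i)^{n+1} f(τ)`. -/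
theorem Ehat_antiholomorphic_derivative (n : ℕ) (f : ℂ → ℂ)
    (hf : DifferentiableOn ℂ f {τ : ℂ | 0 < τ.im})
    (hdecay : ∃ C c : ℝ, 0 < C ∧ 0 < c ∧
      ∀ τ : ℂ, 0 < τ.im → ‖f τ‖ ≤ C * Real.exp (-c * τ.im))
    (τ : ℂ) (hτ : 0 < τ.im) :
    wderBar (Ehat n f) τ = -(-(2 * Complex.I * (τ.im : ℂ))) ^ n *
      (starRingEnd ℂ) (f τ) ∧
    2 * Complex.I * ((τ.im : ℂ)) ^ (-(n : ℤ)) *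
        (starRingEnd ℂ) (wderBar (Ehat n f) τ) =
      -(2 * Complex.I) ^ (n + 1) * f τ := by
  obtain ⟨C, c, hC, hc, hdecay⟩ := hdecay
  have hτ' : (τ.im : ℂ) ≠ 0 := by exact_mod_cast hτ.ne'
  rw [wderBar_Ehat n hf hC hc hdecay hτ]
  constructor
  · simp only [map_neg, map_mul, map_pow, map_ofNat, Complex.conj_I, Complex.conj_ofReal]
    ring
  · rw [Complex.conj_conj, zpow_neg, zpow_natCast, mul_pow]
    field_simp
    ring
end
end

section
/- Let n ≥ 0 be an integer and let f be holomorphic on ℍ with |f(τ)| ≤ C e^{−c Im τ} for some constants C, c > 0. Then the non-holomorphic Eichler integral Ê_n(f) is annihilated by the weight −n hyperbolic Laplacian: Δ_{−n}( Ê_n(f) ) = 0 on ℍ. -/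
open Complex MeasureTheory

noncomputable section

/-- Partial derivative in the direction of the real axis (`∂/∂u`). -/
def pu (F : ℂ → ℂ) (τ : ℂ) : ℂ := fderiv ℝ F τ 1

/-- Partial derivative in the direction of the imaginary axis (`∂/∂v`). -/
def pv (F : ℂ → ℂ) (τ : ℂ) : ℂ := fderiv ℝ F τ Complex.I

/-- The weight `κ` hyperbolic Laplacian
`Δ_κ = −v²(∂²/∂u² + ∂²/∂v²) + iκv(∂/∂u + i∂/∂v)`. -/
def hypLap (κ : ℤ) (F : ℂ → ℂ) (τ : ℂ) : ℂ :=
  -((τ.im : ℂ)) ^ 2 * (pu (pu F) τ + pv (pv F) τ) +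
    Complex.I * (κ : ℂ) * (τ.im : ℂ) * (pu F τ + Complex.I * pv F τ)

/-- The open upper half-plane as a subset of `ℂ`. -/
def upperHalf : Set ℂ := {τ : ℂ | 0 < τ.im}

lemma isOpen_upperHalf : IsOpen upperHalf :=
  isOpen_lt continuous_const Complex.continuous_im

lemma hasFDerivAt_sum_mul_conj {s : Finset ℕ} {p h : ℕ → ℂ → ℂ} {z : ℂ}
    (hp : ∀ k ∈ s, DifferentiableAt ℂ (p k) z) (hh : ∀ k ∈ s, DifferentiableAt ℂ (h k) z) :
    DifferentiableAt ℝ (fun z => ∑ k ∈ s, p k z * (starRingEnd ℂ) (h k z)) z ∧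
    ∀ w, fderiv ℝ (fun z => ∑ k ∈ s, p k z * (starRingEnd ℂ) (h k z)) z w =
      ∑ k ∈ s, (deriv (p k) z * w * (starRingEnd ℂ) (h k z) +
        p k z * (starRingEnd ℂ) (deriv (h k) z * w)) := by
  have key : HasFDerivAt (fun z => ∑ k ∈ s, p k z * (starRingEnd ℂ) (h k z)) _ z :=
    HasFDerivAt.fun_sum (𝕜 := ℝ) fun k hk =>
      ((hp k hk).hasDerivAt.hasFDerivAt.restrictScalars ℝ).mul
        (Complex.conjCLE.toContinuousLinearMap.hasFDerivAt.comp z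
          ((hh k hk).hasDerivAt.hasFDerivAt.restrictScalars ℝ))
  refine ⟨key.differentiableAt, fun w => ?_⟩
  rw [key.fderiv]
  simp only [_root_.sum_apply]
  refine Finset.sum_congr rfl fun k _ => ?_
  simp
  ring

/-- The hyperbolic Laplacian of `∑ p_k conj(h_k)` for holomorphic `p_k`, `h_k`. -/
lemma hypLap_sum_mul_conj (κ : ℤ) {s : Finset ℕ} {p h : ℕ → ℂ → ℂ}
    (hp : ∀ k ∈ s, DifferentiableOn ℂ (p k) upperHalf)
    (hh : ∀ k ∈ s, DifferentiableOn ℂ (h k) upperHalf) {τ : ℂ} (hτ : τ ∈ upperHalf) :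
    hypLap κ (fun z => ∑ k ∈ s, p k z * (starRingEnd ℂ) (h k z)) τ =
      -4 * (τ.im : ℂ) ^ 2 * (∑ k ∈ s, deriv (p k) τ * (starRingEnd ℂ) (deriv (h k) τ)) +
      2 * Complex.I * κ * τ.im * (∑ k ∈ s, p k τ * (starRingEnd ℂ) (deriv (h k) τ)) := by
  have at_ {g : ℂ → ℂ} (hg : DifferentiableOn ℂ g upperHalf) {z : ℂ} (hz : z ∈ upperHalf) :
      DifferentiableAt ℂ g z := hg.differentiableAt (isOpen_upperHalf.mem_nhds hz)
  have hp' k (hk : k ∈ s) : DifferentiableOn ℂ (deriv (p k)) upperHalf :=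
    (hp k hk).deriv isOpen_upperHalf
  have hh' k (hk : k ∈ s) : DifferentiableOn ℂ (deriv (h k)) upperHalf :=
    (hh k hk).deriv isOpen_upperHalf
  obtain ⟨dA, fA⟩ := hasFDerivAt_sum_mul_conj (fun k hk => at_ (hp' k hk) hτ)
    (fun k hk => at_ (hh k hk) hτ)
  obtain ⟨dB, fB⟩ := hasFDerivAt_sum_mul_conj (fun k hk => at_ (hp k hk) hτ)
    (fun k hk => at_ (hh' k hk) hτ)
  have first {z : ℂ} (hz : z ∈ upperHalf) := (hasFDerivAt_sum_mul_conj
    (fun k hk => at_ (hp k hk) hz) (fun k hk => at_ (hh k hk) hz)).2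
  have hu {z : ℂ} (hz : z ∈ upperHalf) :
      pu (fun z => ∑ k ∈ s, p k z * (starRingEnd ℂ) (h k z)) z =
        (∑ k ∈ s, deriv (p k) z * (starRingEnd ℂ) (h k z)) +
          ∑ k ∈ s, p k z * (starRingEnd ℂ) (deriv (h k) z) := by
    simp only [pu, first hz, Finset.sum_add_distrib, mul_one]
  have hv {z : ℂ} (hz : z ∈ upperHalf) :
      pv (fun z => ∑ k ∈ s, p k z * (starRingEnd ℂ) (h k z)) z =
        Complex.I * ((∑ k ∈ s, deriv (p k) z * (starRingEnd ℂ) (h k z)) -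
          ∑ k ∈ s, p k z * (starRingEnd ℂ) (deriv (h k) z)) := by
    simp only [pv, first hz, ← Finset.sum_sub_distrib, Finset.mul_sum]
    refine Finset.sum_congr rfl fun k _ => ?_
    simp only [map_mul, Complex.conj_I]
    ring
  have huu := Filter.EventuallyEq.fderiv_eq (𝕜 := ℝ)
    ((isOpen_upperHalf.eventually_mem hτ).mono fun z hz => hu hz)
  have hvv := Filter.EventuallyEq.fderiv_eq (𝕜 := ℝ)
    ((isOpen_upperHalf.eventually_mem hτ).mono fun z hz => hv hz)
  rw [fderiv_fun_add dA dB] at huu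
  rw [fderiv_const_mul (dA.fun_sub dB), fderiv_fun_sub dA dB] at hvv
  have huu' : pu (pu (fun z => ∑ k ∈ s, p k z * (starRingEnd ℂ) (h k z))) τ = _ :=
    congrArg (fun L => L 1) huu
  have hvv' : pv (pv (fun z => ∑ k ∈ s, p k z * (starRingEnd ℂ) (h k z))) τ = _ :=
    congrArg (fun L => L Complex.I) hvv
  simp only [hypLap, huu', hvv', hu hτ, hv hτ]
  simp only [_root_.add_apply, _root_.smul_apply,
    _root_.sub_apply, fA, fB, Finset.sum_add_distrib, smul_eq_mul, map_mul,
    Complex.conj_I, mul_one, mul_neg, Finset.sum_neg_distrib]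
  simp only [mul_right_comm _ Complex.I, ← mul_assoc, ← Finset.sum_mul]
  linear_combination (-(τ.im : ℂ) ^ 2 *
    ((∑ k ∈ s, deriv (deriv (p k)) τ * (starRingEnd ℂ) (h k τ))
     + (∑ k ∈ s, p k τ * (starRingEnd ℂ) (deriv (deriv (h k)) τ))
     - 2 * (∑ k ∈ s, deriv (p k) τ * (starRingEnd ℂ) (deriv (h k) τ))) +
    Complex.I * κ * τ.im * ((∑ k ∈ s, deriv (p k) τ * (starRingEnd ℂ) (h k τ)) -
      ∑ k ∈ s, p k τ * (starRingEnd ℂ) (deriv (h k) τ))) * Complex.I_mul_I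

/-- Exponential decay along vertical rays, locally uniformly in the real part. -/
def VerticalDecay (g : ℂ → ℂ) : Prop :=
  ∀ A : ℝ, ∃ C b : ℝ, 0 < b ∧ ∀ w ∈ upperHalf, |w.re| ≤ A → ‖g w‖ ≤ C * Real.exp (-b * w.im)

lemma VerticalDecay.mul_pow {f : ℂ → ℂ} {C c : ℝ} (hC : 0 < C) (hc : 0 < c)
    (hf : ∀ τ : ℂ, 0 < τ.im → ‖f τ‖ ≤ C * Real.exp (-c * τ.im)) (k : ℕ) :
    VerticalDecay (fun t => f t * t ^ k) := by
  intro A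
  refine ⟨C * ((2 / c) ^ k * (k.factorial * Real.exp (c / 2 * A))), c / 2, by positivity,
    fun w hw hA => ?_⟩
  have hw' : 0 < w.im := hw
  have h1 : ‖w‖ ≤ A + w.im := by
    have := Complex.norm_le_abs_re_add_abs_im w
    rw [abs_of_pos hw'] at this
    linarith
  have hA0 : 0 ≤ A := (abs_nonneg _).trans hA
  have h2 : (c / 2 * (A + w.im)) ^ k / k.factorial ≤ Real.exp (c / 2 * (A + w.im)) :=
    Real.pow_div_factorial_le_exp _ (by positivity) k
  rw [div_le_iff₀ (by positivity)] at h2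
  have h3 : (A + w.im) ^ k = (2 / c) ^ k * (c / 2 * (A + w.im)) ^ k := by
    rw [← _root_.mul_pow]
    congr 1
    field_simp
  calc ‖f w * w ^ k‖ = ‖f w‖ * ‖w‖ ^ k := by simp
    _ ≤ (C * Real.exp (-c * w.im)) * (A + w.im) ^ k := by
      gcongr
      exact hf w hw'
    _ ≤ (C * Real.exp (-c * w.im)) *
        ((2 / c) ^ k * (Real.exp (c / 2 * (A + w.im)) * k.factorial)) := by
      rw [h3]; gcongr
    _ = C * ((2 / c) ^ k * (k.factorial * Real.exp (c / 2 * A))) *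
        Real.exp (-(c / 2) * w.im) := by
      have : Real.exp (-c * w.im) * Real.exp (c / 2 * (A + w.im)) =
          Real.exp (c / 2 * A) * Real.exp (-(c / 2) * w.im) := by
        rw [← Real.exp_add, ← Real.exp_add]; ring_nf
      linear_combination C * (2 / c) ^ k * k.factorial * this

lemma add_mul_I_mem_upperHalf {z : ℂ} (hz : z ∈ upperHalf) {s : ℝ} (hs : 0 ≤ s) :
    z + s * Complex.I ∈ upperHalf := by
  have : 0 < z.im := hz
  simp only [upperHalf, Set.mem_ofPred_eq, Complex.add_im, Complex.mul_im, Complex.ofReal_re,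
    Complex.I_im, Complex.ofReal_im, Complex.I_re]
  linarith

lemma continuousOn_vertical {g : ℂ → ℂ} (hg : ContinuousOn g upperHalf) {z : ℂ}
    (hz : z ∈ upperHalf) :
    ContinuousOn (fun s : ℝ => g (z + s * Complex.I)) (Set.Ioi 0) :=
  hg.comp (by fun_prop) fun _ hs => add_mul_I_mem_upperHalf hz (le_of_lt hs)

lemma aestronglyMeasurable_vertical {g : ℂ → ℂ} (hg : ContinuousOn g upperHalf) {z : ℂ}
    (hz : z ∈ upperHalf) :
    AEStronglyMeasurable (fun s : ℝ => g (z + s * Complex.I)) (volume.restrict (Set.Ioi 0)) :=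
  (continuousOn_vertical hg hz).aestronglyMeasurable measurableSet_Ioi

lemma integrable_exp_bound (C : ℝ) {b : ℝ} (hb : 0 < b) :
    Integrable (fun s : ℝ => C * Real.exp (-b * s)) (volume.restrict (Set.Ioi 0)) :=
  (integrableOn_exp_mul_Ioi (by linarith : -b < 0) 0).const_mul C

lemma VerticalDecay.norm_vertical_le {g : ℂ → ℂ} (hd : VerticalDecay g) (A : ℝ) :
    ∃ C b : ℝ, 0 < b ∧ ∀ z ∈ upperHalf, |z.re| ≤ A → ∀ s : ℝ, 0 ≤ s →
      ‖g (z + s * Complex.I)‖ ≤ C * Real.exp (-b * s) := by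
  obtain ⟨C, b, hb, h⟩ := hd A
  refine ⟨|C|, b, hb, fun z hz hA s hs => ?_⟩
  refine (h _ (add_mul_I_mem_upperHalf hz hs) (by simpa using hA)).trans ?_
  have : 0 < z.im := hz
  refine mul_le_mul (le_abs_self C) (Real.exp_le_exp.2 ?_) (Real.exp_pos _).le (abs_nonneg _)
  simp
  nlinarith

lemma VerticalDecay.integrable {g : ℂ → ℂ} (hd : VerticalDecay g)
    (hg : ContinuousOn g upperHalf) {z : ℂ} (hz : z ∈ upperHalf) :
    Integrable (fun s : ℝ => g (z + s * Complex.I)) (volume.restrict (Set.Ioi 0)) := by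
  obtain ⟨C, b, hb, h⟩ := hd.norm_vertical_le |z.re|
  refine (integrable_exp_bound C hb).mono' (aestronglyMeasurable_vertical hg hz) ?_
  filter_upwards [ae_restrict_mem measurableSet_Ioi] with s hs
  exact h z hz le_rfl s (le_of_lt hs)

/-- The vertical-ray primitive of a decaying holomorphic function. -/
lemma VerticalDecay.hasDerivAt_integral {g : ℂ → ℂ} (hd : VerticalDecay g)
    (hg : DifferentiableOn ℂ g upperHalf) {τ : ℂ} (hτ : τ ∈ upperHalf) :
    HasDerivAt (fun z : ℂ => ∫ s in Set.Ioi (0 : ℝ), g (z + s * Complex.I) * Complex.I)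
      (-g τ) τ := by
  have him : 0 < τ.im := hτ
  set r : ℝ := τ.im / 4 with hr
  have hr0 : 0 < r := by positivity
  have near {w : ℂ} (hw : ‖w - τ‖ ≤ 2 * r) : w ∈ upperHalf ∧ |w.re| ≤ |τ.re| + 2 * r := by
    have h1 := (Complex.abs_im_le_norm (w - τ)).trans hw
    have h2 := (Complex.abs_re_le_norm (w - τ)).trans hw
    rw [Complex.sub_im] at h1
    rw [Complex.sub_re] at h2
    refine ⟨?_, ?_⟩
    · have := (abs_le.1 h1).1
      show 0 < w.im
      linarith
    · have := abs_add_le (w.re - τ.re) τ.re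
      rw [sub_add_cancel] at this
      linarith
  obtain ⟨C, b, hb, hbound⟩ := hd.norm_vertical_le (|τ.re| + 2 * r)
  have ball_near {x : ℂ} (hx : x ∈ Metric.ball τ r) : ‖x - τ‖ ≤ r := by
    rw [Metric.mem_ball, dist_eq_norm] at hx
    exact hx.le
  have hderiv {z : ℂ} (hz : z ∈ upperHalf) {s : ℝ} (hs : 0 ≤ s) :
      HasDerivAt g (deriv g (z + s * Complex.I)) (z + s * Complex.I) :=
    (hg.differentiableAt (isOpen_upperHalf.mem_nhds (add_mul_I_mem_upperHalf hz hs))).hasDerivAt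
  have hcont' : ContinuousOn (deriv g) upperHalf := (hg.deriv isOpen_upperHalf).continuousOn
  have hest : ∀ x ∈ Metric.ball τ r, ∀ s : ℝ, 0 ≤ s →
      ‖deriv g (x + s * Complex.I)‖ ≤ C / r * Real.exp (-b * s) := by
    intro x hx s hs
    have hx' := ball_near hx
    have shift {w : ℂ} (hw : w ∈ Metric.closedBall (x + s * Complex.I) r) :
        ‖(w - s * Complex.I) - τ‖ ≤ 2 * r := by
      rw [Metric.mem_closedBall, dist_eq_norm] at hw
      calc ‖(w - s * Complex.I) - τ‖ = ‖(w - (x + s * Complex.I)) + (x - τ)‖ := by ring_nf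
        _ ≤ r + r := (norm_add_le _ _).trans (add_le_add hw hx')
        _ = 2 * r := by ring
    have hsub : Metric.closedBall (x + s * Complex.I) r ⊆ upperHalf := fun w hw => by
      simpa using add_mul_I_mem_upperHalf (near (shift hw)).1 hs
    have := Complex.norm_deriv_le_of_forall_mem_sphere_norm_le hr0
      ((hg.mono hsub).diffContOnCl_ball subset_rfl) (C := C * Real.exp (-b * s))
      fun w hw => by
        have hw' := shift (Metric.sphere_subset_closedBall hw)
        simpa using hbound _ (near hw').1 (near hw').2 s hs
    rwa [mul_div_right_comm] at this
  have hF := hasDerivAt_integral_of_dominated_loc_of_deriv_le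
    (μ := volume.restrict (Set.Ioi (0 : ℝ)))
    (F := fun z s => g (z + (s : ℝ) * Complex.I) * Complex.I)
    (F' := fun z s => deriv g (z + (s : ℝ) * Complex.I) * Complex.I)
    (bound := fun s => C / r * Real.exp (-b * s)) (x₀ := τ) (s := Metric.ball τ r)
    (Metric.ball_mem_nhds τ hr0)
    (by
      filter_upwards [isOpen_upperHalf.mem_nhds hτ] with x hx
      exact (aestronglyMeasurable_vertical hg.continuousOn hx).mul_const _)
    ((hd.integrable hg.continuousOn hτ).mul_const _)
    ((aestronglyMeasurable_vertical hcont' hτ).mul_const _)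
    (by
      filter_upwards [ae_restrict_mem measurableSet_Ioi] with s hs x hx
      simpa using hest x hx s (le_of_lt hs))
    (integrable_exp_bound _ hb)
    (by
      filter_upwards [ae_restrict_mem measurableSet_Ioi] with s hs x hx
      have hx' := (near ((ball_near hx).trans (by linarith))).1
      exact ((hderiv hx' (le_of_lt hs)).comp_add_const x (s * Complex.I)).mul_const _)
  have hpath {s : ℝ} (hs : 0 ≤ s) : HasDerivAt (fun s : ℝ => g (τ + s * Complex.I))
      (deriv g (τ + s * Complex.I) * Complex.I) s := by
    have h1 : HasDerivAt (fun s : ℝ => τ + s * Complex.I) Complex.I s := by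
      simpa using ((hasDerivAt_id s).ofReal_comp.mul_const Complex.I).const_add τ
    exact (hderiv hτ hs).comp s h1
  have hlim : Filter.Tendsto (fun s : ℝ => g (τ + s * Complex.I)) Filter.atTop (nhds 0) := by
    refine squeeze_zero_norm' (a := fun s => C * Real.exp (-b * s)) ?_ ?_
    · filter_upwards [Filter.eventually_ge_atTop 0] with s hs
      exact hbound τ hτ (by linarith) s hs
    · have h1 : Filter.Tendsto (fun s : ℝ => -b * s) Filter.atTop Filter.atBot :=
        Filter.tendsto_id.const_mul_atTop_of_neg (by linarith)
      simpa using (Real.tendsto_exp_atBot.comp h1).const_mul C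
  have hval := integral_Ioi_of_hasDerivAt_of_tendsto' (fun s hs => hpath hs) hF.1 hlim
  simp only [Complex.ofReal_zero, zero_mul, add_zero, zero_sub] at hval
  exact hval ▸ hF.2

/-- Binomial expansion of the non-holomorphic Eichler integral. -/
lemma Ehat_eq_sum (n : ℕ) {f : ℂ → ℂ} (hf : ContinuousOn f upperHalf)
    (hd : ∀ k, VerticalDecay (fun t => f t * t ^ k)) {z : ℂ} (hz : z ∈ upperHalf) :
    Ehat n f z = ∑ k ∈ Finset.range (n + 1), ((-z) ^ (n - k) * (n.choose k : ℂ)) *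
      (starRingEnd ℂ) (∫ s in Set.Ioi (0 : ℝ),
        f (z + s * Complex.I) * (z + s * Complex.I) ^ k * Complex.I) := by
  have hint (k : ℕ) : Integrable (fun s : ℝ =>
      f (z + s * Complex.I) * (z + s * Complex.I) ^ k * Complex.I)
      (volume.restrict (Set.Ioi 0)) :=
    ((hd k).integrable (hf.mul (by fun_prop)) hz).mul_const _
  have hexp (s : ℝ) : f (z + s * Complex.I) *
      ((z + s * Complex.I) - (starRingEnd ℂ) z) ^ n * Complex.I =
      ∑ k ∈ Finset.range (n + 1), ((-(starRingEnd ℂ) z) ^ (n - k) * (n.choose k : ℂ)) *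
        (f (z + s * Complex.I) * (z + s * Complex.I) ^ k * Complex.I) := by
    rw [sub_eq_add_neg, add_pow, Finset.mul_sum, Finset.sum_mul]
    exact Finset.sum_congr rfl fun k _ => by ring
  simp only [Ehat, hexp]
  rw [integral_finsetSum _ fun k _ => (hint k).const_mul _, map_sum]
  refine Finset.sum_congr rfl fun k _ => ?_
  rw [integral_const_mul]
  simp

lemma Filter.EventuallyEq.hypLap_eq {κ : ℤ} {F G : ℂ → ℂ} {τ : ℂ} (h : F =ᶠ[nhds τ] G) :
    hypLap κ F τ = hypLap κ G τ := by
  have hu : pu F =ᶠ[nhds τ] pu G := h.fderiv.fun_comp (fun L : ℂ →L[ℝ] ℂ => L 1)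
  have hv : pv F =ᶠ[nhds τ] pv G := h.fderiv.fun_comp (fun L : ℂ →L[ℝ] ℂ => L Complex.I)
  have huu : pu (pu F) τ = pu (pu G) τ := by rw [pu, hu.fderiv_eq, ← pu]
  have hvv : pv (pv F) τ = pv (pv G) τ := by rw [pv, hv.fderiv_eq, ← pv]
  simp only [hypLap, huu, hvv, hu.eq_of_nhds, hv.eq_of_nhds]

/-- for `f` holomorphic on `ℍ` with exponential decay, the
non-holomorphic Eichler integral is annihilated by the weight `−n` hyperbolic
Laplacian: `Δ_{−n}(Ê_n(f)) = 0` on `ℍ`. -/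
theorem Ehat_hyperbolic_laplacian (n : ℕ) (f : ℂ → ℂ)
    (hf : DifferentiableOn ℂ f {τ : ℂ | 0 < τ.im})
    (hdecay : ∃ C c : ℝ, 0 < C ∧ 0 < c ∧
      ∀ τ : ℂ, 0 < τ.im → ‖f τ‖ ≤ C * Real.exp (-c * τ.im))
    (τ : ℂ) (hτ : 0 < τ.im) :
    hypLap (-(n : ℤ)) (Ehat n f) τ = 0 := by
  obtain ⟨C, c, hC, hc, hbound⟩ := hdecay
  have hf' : DifferentiableOn ℂ f upperHalf := hf
  have hd := VerticalDecay.mul_pow hC hc hbound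
  have hH (k : ℕ) {z : ℂ} (hz : z ∈ upperHalf) :=
    (hd k).hasDerivAt_integral (hf'.mul (by fun_prop)) hz
  have hcong : Ehat n f =ᶠ[nhds τ] _ := (isOpen_upperHalf.eventually_mem hτ).mono
    fun z hz => Ehat_eq_sum n hf'.continuousOn hd hz
  rw [hcong.hypLap_eq, hypLap_sum_mul_conj _
    (p := fun k z => (-z) ^ (n - k) * (n.choose k : ℂ))
    (h := fun k z => ∫ s in Set.Ioi (0 : ℝ),
        f (z + s * Complex.I) * (z + s * Complex.I) ^ k * Complex.I)
    (fun k _ => by fun_prop)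
    (fun k _ z hz => (hH k hz).differentiableAt.differentiableWithinAt) hτ]
  simp only [(hH _ hτ).deriv]
  set a : ℂ := (starRingEnd ℂ) τ with ha
  have hsum (z : ℂ) : ∑ k ∈ Finset.range (n + 1), (-z) ^ (n - k) * (n.choose k : ℂ) * a ^ k =
      (a - z) ^ n := by
    rw [sub_eq_add_neg, add_pow]
    exact Finset.sum_congr rfl fun k _ => by ring
  have hsum' : ∑ k ∈ Finset.range (n + 1),
      deriv (fun z : ℂ => (-z) ^ (n - k) * (n.choose k : ℂ)) τ * a ^ k =
      -(n * (a - τ) ^ (n - 1)) := by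
    have h1 : HasDerivAt (fun z : ℂ => ∑ k ∈ Finset.range (n + 1),
        (-z) ^ (n - k) * (n.choose k : ℂ) * a ^ k) (∑ k ∈ Finset.range (n + 1),
        deriv (fun z : ℂ => (-z) ^ (n - k) * (n.choose k : ℂ)) τ * a ^ k) τ :=
      HasDerivAt.fun_sum fun k _ => (DifferentiableAt.hasDerivAt (by fun_prop)).mul_const _
    have h2 : HasDerivAt (fun z : ℂ => (a - z) ^ n) (n * (a - τ) ^ (n - 1) * (-1)) τ :=
      ((hasDerivAt_id τ).const_sub a).pow n
    simp only [hsum] at h1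
    rw [h1.unique h2]
    ring
  have h1 : ∑ k ∈ Finset.range (n + 1), (-τ) ^ (n - k) * (n.choose k : ℂ) *
      (starRingEnd ℂ) (-(f τ * τ ^ k)) = -(starRingEnd ℂ) (f τ) * (a - τ) ^ n := by
    rw [← hsum τ, Finset.mul_sum]
    refine Finset.sum_congr rfl fun k _ => ?_
    simp only [map_neg, map_mul, map_pow, ← ha]
    ring
  have h2 : ∑ k ∈ Finset.range (n + 1),
      deriv (fun z : ℂ => (-z) ^ (n - k) * (n.choose k : ℂ)) τ *
      (starRingEnd ℂ) (-(f τ * τ ^ k)) =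
      (starRingEnd ℂ) (f τ) * (n * (a - τ) ^ (n - 1)) := by
    rw [← neg_neg ((n : ℂ) * (a - τ) ^ (n - 1)), ← hsum', mul_neg, ← neg_mul, Finset.mul_sum]
    refine Finset.sum_congr rfl fun k _ => ?_
    simp only [map_neg, map_mul, map_pow, ← ha]
    ring
  rw [h1, h2]
  have hsub : a - τ = -2 * τ.im * Complex.I := by
    have := Complex.sub_conj τ
    push_cast at this
    linear_combination -this
  rcases n with _ | m
  · simp
  · rw [hsub, Nat.add_sub_cancel, pow_succ]
    push_cast
    linear_combination (-4 * (τ.im : ℂ) ^ 2 * (m + 1) * (starRingEnd ℂ) (f τ) *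
      (-2 * τ.im * Complex.I) ^ m) * Complex.I_mul_I
end
end
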